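/- arXiv:2407.06997 — 5 statements merged into one kernel-verified Lean document; each statement's English description precedes it below -/
import Mathlib

section
/- For every nonempty open subset 𝒱 of ℝ, the set {R_θ : θ ∈ 𝒱 irrational} of irrational rotations with angle in 𝒱 is a flexible class of rank-one systems. -/
/-- A measure-theoretic dynamical system: an invertible bimeasurable transformation
of a measure space. -/
structure MSystem where
  carrier : Type
  [meas : MeasurableSpace carrier]
  μ : MeasureTheory.Measure carrier
  T : carrier ≃ᵐ carrier

attribute [instance] MSystem.meas

open MeasureTheory Filter Set Topology

/-- A cutting and spacing parameter: an integer `q ≥ 2` (the cutting parameter) together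
with nonnegative integers `σ 0, …, σ q` (the spacing parameters), represented as a
function `ℕ → ℕ` vanishing above `q`. -/
structure CSParam where
  q : ℕ
  two_le_q : 2 ≤ q
  σ : ℕ → ℕ
  σ_eq_zero_of_gt : ∀ i, q < i → σ i = 0

/-- The total number `σ_n = σ_{n,0} + ⋯ + σ_{n,q_n}` of spacers added at one step. -/
def CSParam.σtot (P : CSParam) : ℕ := ∑ i ∈ Finset.range (P.q + 1), P.σ i

/-- The height sequence associated with a sequence of cutting and spacing parameters:
`h 0 = 1` and `h (n+1) = q_n · h_n + σ_n`. -/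
def heights (p : ℕ → CSParam) : ℕ → ℕ
  | 0 => 1
  | n + 1 => (p n).q * heights p n + (p n).σtot

/-- `Z_n`, the maximum spacing parameter over the first `n+1` steps. -/
def Zmax (p : ℕ → CSParam) (n : ℕ) : ℕ :=
  (Finset.range (n + 1)).sup fun j => (Finset.range ((p j).q + 1)).sup (p j).σ

/-- Condition (F): the series `Σ σ_n / h_{n+1}` converges. -/
def CondF (p : ℕ → CSParam) : Prop :=
  Summable fun n => ((p n).σtot : ℝ) / (heights p (n + 1) : ℝ)

/-- The level of the `(n+1)`-th tower at which the `i`-th subcolumn of the `n`-th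
tower starts, namely `σ_{n,0} + ⋯ + σ_{n,i} + i·h_n`. -/
def colStart (p : ℕ → CSParam) (n i : ℕ) : ℕ :=
  (∑ j ∈ Finset.range (i + 1), (p n).σ j) + i * heights p n

/-- The subset `X_n` covered by the `n`-th tower. -/
def towerUnion {X : Type} [MeasurableSpace X] (T : X ≃ᵐ X) (p : ℕ → CSParam)
    (B : ℕ → Set X) (n : ℕ) : Set X :=
  ⋃ k ∈ Finset.range (heights p n), (⇑T)^[k] '' B n

/-- A cutting-and-stacking tower structure for `T`, with parameters `p`, bases `B n`
(so that the `n`-th tower has levels `T^k (B n)`, `k < h_n`), and subdivision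
`Bsub n 0, …, Bsub n (q_n - 1)` of `B n`: the `(n+1)`-th tower is obtained by stacking,
in order, `σ_{n,0}` spacer levels, the subcolumn over `Bsub n 0`, `σ_{n,1}` spacer levels,
…, the subcolumn over `Bsub n (q_n-1)`, and `σ_{n,q_n}` spacer levels on top, the spacer
levels being disjoint from `X_n`. -/
structure IsCuttingStacking {X : Type} [MeasurableSpace X] (T : X ≃ᵐ X)
    (p : ℕ → CSParam) (B : ℕ → Set X) (Bsub : ℕ → ℕ → Set X) : Prop where
  meas_base : ∀ n, MeasurableSet (B n)
  meas_sub : ∀ n, ∀ i < (p n).q, MeasurableSet (Bsub n i)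
  disj_levels : ∀ n, ∀ k < heights p n, ∀ l < heights p n, k ≠ l →
    Disjoint ((⇑T)^[k] '' B n) ((⇑T)^[l] '' B n)
  disj_sub : ∀ n, ∀ i < (p n).q, ∀ j < (p n).q, i ≠ j → Disjoint (Bsub n i) (Bsub n j)
  union_sub : ∀ n, B n = ⋃ i ∈ Finset.range (p n).q, Bsub n i
  subcolumn : ∀ n, ∀ i < (p n).q, ∀ k < heights p n,
    (⇑T)^[colStart p n i + k] '' B (n + 1) = (⇑T)^[k] '' Bsub n i
  spacer_disjoint : ∀ n, ∀ l < heights p (n + 1),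
    (∀ i < (p n).q, ∀ k < heights p n, l ≠ colStart p n i + k) →
    Disjoint ((⇑T)^[l] '' B (n + 1)) (towerUnion T p B n)

/-- The towers with bases `B n` increase to the full σ-algebra modulo `μ`-null sets. -/
def TowersGenerate {X : Type} [MeasurableSpace X] (μ : Measure X) (T : X ≃ᵐ X)
    (p : ℕ → CSParam) (B : ℕ → Set X) : Prop :=
  ∀ A : Set X, MeasurableSet A → ∃ A' : Set X,
    MeasurableSet[MeasurableSpace.generateFrom
      {s : Set X | ∃ n k, k < heights p n ∧ s = (⇑T)^[k] '' B n}] A' ∧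
    μ (symmDiff A A') = 0

/-- `T` is a rank-one system with cutting and spacing parameters `p` on `(X, μ)`. -/
def IsRankOneWith {X : Type} [MeasurableSpace X] (μ : Measure X) (T : X ≃ᵐ X)
    (p : ℕ → CSParam) : Prop :=
  MeasurePreserving T μ μ ∧ CondF p ∧
    ∃ B Bsub, IsCuttingStacking T p B Bsub ∧ TowersGenerate μ T p B

/-- `T` is a rank-one system on `(X, μ)`. -/
def IsRankOne {X : Type} [MeasurableSpace X] (μ : Measure X) (T : X ≃ᵐ X) : Prop :=
  ∃ p, IsRankOneWith μ T p

/-- Iterates, indexed by `ℤ`, of a measurable equivalence. -/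
def zIter {X : Type} [MeasurableSpace X] (T : X ≃ᵐ X) (n : ℤ) (x : X) : X :=
  if 0 ≤ n then (⇑T)^[n.toNat] x else (⇑T.symm)^[(-n).toNat] x

/-- The `T`-orbit of a point. -/
def orbit {X : Type} [MeasurableSpace X] (T : X ≃ᵐ X) (x : X) : Set X :=
  Set.range fun n : ℤ => zIter T n x

/-- `S` is the universal odometer: a rank-one system admitting a construction with no
spacers whose cutting parameters `q'_n` are such that every positive integer divides
some product `q'_0 ⋯ q'_{n-1}`. -/
def IsUniversalOdometer {X : Type} [MeasurableSpace X] (μ : Measure X) (S : X ≃ᵐ X) : Prop :=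
  ∃ p : ℕ → CSParam, IsRankOneWith μ S p ∧ (∀ n i, (p n).σ i = 0) ∧
    ∀ N : ℕ, 0 < N → ∃ n, N ∣ ∏ k ∈ Finset.range n, (p k).q

/-- `T` (acting on `(X,μ)`) and `S` (acting on `(Y,ν)`) are φ-integrably orbit
equivalent: there is a measure-preserving bimeasurable bijection matching a.e. `T`-orbit
with the corresponding `S`-orbit, whose cocycles `c_T`, `c_S` satisfy
`∫ φ(|c_T|) dμ < ∞` and `∫ φ(|c_S|) dν < ∞`. -/
def PhiIntegrablyOE {X Y : Type} [MeasurableSpace X] [MeasurableSpace Y]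
    (μ : Measure X) (T : X ≃ᵐ X) (ν : Measure Y) (S : Y ≃ᵐ Y) (φ : ℝ → ℝ) : Prop :=
  ∃ Ψ : X ≃ᵐ Y, MeasurePreserving Ψ μ ν ∧
    (∀ᵐ x ∂μ, Ψ '' orbit T x = orbit S (Ψ x)) ∧
    ∃ cT : X → ℤ, ∃ cS : Y → ℤ,
      Measurable cT ∧ Measurable cS ∧
      (∀ᵐ x ∂μ, Ψ (T x) = zIter S (cT x) (Ψ x)) ∧
      (∀ᵐ y ∂ν, Ψ.symm (S y) = zIter T (cS y) (Ψ.symm y)) ∧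
      Integrable (fun x => φ |(cT x : ℝ)|) μ ∧
      Integrable (fun y => φ |(cS y : ℝ)|) ν

/-- The underlying space is a standard atomless probability space. -/
def MSystem.Standard (𝒮 : MSystem) : Prop :=
  StandardBorelSpace 𝒮.carrier ∧ IsProbabilityMeasure 𝒮.μ ∧ NoAtoms 𝒮.μ

/-- `T` is φ-integrably orbit equivalent to the universal odometer. -/
def PhiOEToUnivOdometer {X : Type} [MeasurableSpace X] (μ : Measure X) (T : X ≃ᵐ X)
    (φ : ℝ → ℝ) : Prop :=
  ∃ 𝒮 : MSystem, 𝒮.Standard ∧ IsUniversalOdometer 𝒮.μ 𝒮.T ∧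
    PhiIntegrablyOE μ T 𝒮.μ 𝒮.T φ

/-- `φ(t) = o(t^{1/3})` as `t → ∞`. -/
def SmallOCbrt (φ : ℝ → ℝ) : Prop :=
  Tendsto (fun t : ℝ => φ t / t ^ ((1 : ℝ) / 3)) atTop (nhds 0)

/-- The height reached after applying a finite list of cutting and spacing parameters
(`h_n` for a list of length `n`). -/
def listHeight (L : List CSParam) : ℕ := L.foldl (fun h P => P.q * h + P.σtot) 1

/-- A class `𝒞` of systems is flexible: there is a set `F` of finite sequences of
cutting and spacing parameters such that (1) for some constant `C > 0`, every infinite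
parameter sequence satisfying condition (F) all of whose initial segments lie in `F`
satisfies `Z_n ≤ C·h_n` for all `n`, and every rank-one system admitting a
cutting-and-stacking construction with these parameters belongs to `𝒞`; (2) `F`
contains a length-one sequence with cutting parameter `≥ 3`; and (3) for some constant
`C' > 0`, every nonempty sequence of `F` (say of length `n`) can be extended inside `F`
by infinitely many choices of cutting parameter `q_n`, with spacing parameters
satisfying `σ_n ≤ C'·q_n·h_{n-1}`. -/
def IsFlexibleClass (𝒞 : MSystem → Prop) : Prop :=
  ∃ F : Set (List CSParam),
    (∃ C : ℝ, 0 < C ∧ ∀ p : ℕ → CSParam, CondF p →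
      (∀ n : ℕ, (List.ofFn fun k : Fin (n + 1) => p k.val) ∈ F) →
      (∀ n, (Zmax p n : ℝ) ≤ C * (heights p n : ℝ)) ∧
      ∀ 𝒮 : MSystem, 𝒮.Standard → IsRankOneWith 𝒮.μ 𝒮.T p → 𝒞 𝒮) ∧
    (∃ P : CSParam, [P] ∈ F ∧ 3 ≤ P.q) ∧
    (∃ C' : ℝ, 0 < C' ∧ ∀ L : List CSParam, L ∈ F → L ≠ [] →
      {q : ℕ | ∃ P : CSParam, P.q = q ∧
        (P.σtot : ℝ) ≤ C' * (q : ℝ) * (listHeight L.dropLast : ℝ) ∧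
        L ++ [P] ∈ F}.Infinite)

/-- The systems `T` on `(X,μ)` and `S` on `(Y,ν)` are conjugate (isomorphic). -/
def Conjugate {X Y : Type} [MeasurableSpace X] [MeasurableSpace Y]
    (μ : MeasureTheory.Measure X) (T : X ≃ᵐ X)
    (ν : MeasureTheory.Measure Y) (S : Y ≃ᵐ Y) : Prop :=
  ∃ Ψ : X ≃ᵐ Y, MeasureTheory.MeasurePreserving Ψ μ ν ∧ ∀ᵐ x ∂μ, Ψ (T x) = S (Ψ x)

/-- The rotation of angle `θ` on the circle `ℝ/ℤ` (equipped with its Haar probability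
measure `volume`), as a measurable equivalence. -/
noncomputable def rot (θ : ℝ) : AddCircle (1 : ℝ) ≃ᵐ AddCircle (1 : ℝ) :=
  MeasurableEquiv.addLeft (θ : AddCircle (1 : ℝ))

theorem convergent_det {H a : ℕ → ℕ} {P : ℕ → ℤ}
    (hH : ∀ n, H (n + 2) = a (n + 1) * H (n + 1) + H n)
    (hP : ∀ n, P (n + 2) = a (n + 1) * P (n + 1) + P n)
    (hdet : P 1 * H 0 - P 0 * H 1 = 1) (n : ℕ) :
    P (n + 1) * H n - P n * H (n + 1) = (-1) ^ n := by
  induction n with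
  | zero => simpa using hdet
  | succ n ih =>
    rw [hP, hH, pow_succ, ← ih]
    push_cast
    ring

/-- The limit of a sequence of convergents lies strictly between consecutive convergents. -/
theorem exists_angle_of_convergents {H a : ℕ → ℕ} {P : ℕ → ℤ}
    (hpos : ∀ n, 0 < H n) (ha : ∀ n, 0 < a (n + 1))
    (hH : ∀ n, H (n + 2) = a (n + 1) * H (n + 1) + H n)
    (hP : ∀ n, P (n + 2) = a (n + 1) * P (n + 1) + P n)
    (hdet : P 1 * H 0 - P 0 * H 1 = 1) :
    ∃ θ : ℝ, ∀ n, 0 < (-1) ^ n * (H n * θ - P n) := by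
  have hpos' : ∀ n, (0 : ℝ) < H n := fun n => by exact_mod_cast hpos n
  have hd : ∀ n, (P (n + 1) * H n - P n * H (n + 1) : ℝ) = (-1) ^ n := fun n => by
    exact_mod_cast convergent_det hH hP hdet n
  have hd2 : ∀ n, (P (n + 2) * H n - P n * H (n + 2) : ℝ) = a (n + 1) * (-1) ^ n := fun n => by
    rw [hP, hH, ← hd n]
    push_cast
    ring
  have ha' : ∀ n, (0 : ℝ) < a (n + 1) := fun n => by exact_mod_cast ha n
  have heven : ∀ n, (P (2 * n) : ℝ) / H (2 * n) < P (2 * (n + 1)) / H (2 * (n + 1)) := fun n => by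
    rw [div_lt_div_iff₀ (hpos' _) (hpos' _), ← sub_pos, mul_add, mul_one, hd2 (2 * n)]
    simpa using ha (2 * n)
  have hodd : ∀ n, (P (2 * (n + 1) + 1) : ℝ) / H (2 * (n + 1) + 1)
      < P (2 * n + 1) / H (2 * n + 1) := fun n => by
    rw [div_lt_div_iff₀ (hpos' _) (hpos' _), ← sub_neg, mul_add, mul_one, add_right_comm,
      hd2 (2 * n + 1)]
    simpa [pow_succ] using ha (2 * n + 1)
  have hle : (fun n => (P (2 * n) : ℝ) / H (2 * n)) ≤
      fun n => (P (2 * n + 1) : ℝ) / H (2 * n + 1) := fun n => by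
    change (P (2 * n) : ℝ) / H (2 * n) ≤ (P (2 * n + 1) : ℝ) / H (2 * n + 1)
    rw [div_le_div_iff₀ (hpos' _) (hpos' _), ← sub_nonneg, hd (2 * n)]
    simp
  have hmem := (strictMono_nat_of_lt_succ heven).monotone.ciSup_mem_iInter_Icc_of_antitone
    (strictAnti_nat_of_succ_lt hodd).antitone hle
  set θ := ⨆ n, (P (2 * n) : ℝ) / H (2 * n)
  rw [mem_iInter] at hmem
  refine ⟨θ, fun n => ?_⟩
  obtain ⟨k, rfl | rfl⟩ := n.even_or_odd'
  · have := (heven k).trans_le (hmem (k + 1)).1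
    rw [div_lt_iff₀ (hpos' _)] at this
    simp only [even_two, Even.mul_right, Even.neg_pow, one_pow, one_mul]
    linarith
  · have := (hmem (k + 1)).2.trans_lt (hodd k)
    rw [lt_div_iff₀ (hpos' _)] at this
    simp only [pow_succ, even_two, Even.mul_right, Even.neg_pow, one_pow, one_mul]
    linarith

/-- Best approximation property of convergents. -/
theorem convergent_best_approx {H : ℕ → ℕ} {P : ℕ → ℤ} {θ : ℝ}
    (hdet : ∀ n, P (n + 1) * H n - P n * H (n + 1) = (-1) ^ n)
    (hθ : ∀ n, 0 < (-1) ^ n * (H n * θ - P n)) (n : ℕ) (j m : ℤ) (hj0 : j ≠ 0)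
    (hj : |j| < H (n + 1)) :
    |H n * θ - P n| ≤ |j * θ - m| := by
  obtain ⟨s, hs, hss⟩ : ∃ s : ℤ, (-1) ^ n = s ∧ s * s = 1 :=
    ⟨(-1) ^ n, rfl, by rw [← mul_pow]; simp⟩
  have hd := hdet n
  rw [hs] at hd
  have e0 := hθ n
  have e1 := hθ (n + 1)
  have hs' : ((-1 : ℝ)) ^ n = s := by exact_mod_cast congrArg (Int.cast (R := ℝ)) hs
  have hss' : (s : ℝ) * s = 1 := by exact_mod_cast hss
  rw [pow_succ, hs'] at e1
  rw [hs'] at e0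
  set u := (H n : ℝ) * θ - P n with hu
  set v := (H (n + 1) : ℝ) * θ - P (n + 1) with hv
  obtain ⟨A, B, hjA, hmA⟩ : ∃ A B : ℤ, j = A * H n + B * H (n + 1) ∧ m = A * P n + B * P (n + 1) :=
    ⟨s * (j * P (n + 1) - m * H (n + 1)), s * (m * H n - j * P n),
      by linear_combination (-j) * s * hd - j * hss, by linear_combination (-m) * s * hd - m * hss⟩
  have hjm : (j : ℝ) * θ - m = A * u + B * v := by
    rw [hjA, hmA, hu, hv]
    push_cast
    ring
  have hH0 : (0 : ℤ) ≤ H n := by positivity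
  have hH1 : (0 : ℤ) ≤ H (n + 1) := by positivity
  rw [hjm]
  have habs : ∀ x : ℝ, |x| = |s * x| := fun x => by
    have : |(s : ℝ)| * |(s : ℝ)| = 1 := by rw [← abs_mul, hss', abs_one]
    have : |(s : ℝ)| = 1 := by nlinarith [abs_nonneg (s : ℝ)]
    rw [abs_mul, this, one_mul]
  rw [habs u, habs (A * u + B * v), abs_of_pos e0]
  rw [abs_lt] at hj
  have hA : A ≠ 0 := by
    rintro rfl
    rcases lt_trichotomy B 0 with hB | rfl | hB
    · nlinarith
    · simp at hjA; exact hj0 hjA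
    · nlinarith
  rcases lt_or_gt_of_ne hA with hA | hA
  · have hB : 0 ≤ B := by
      by_contra! hB
      nlinarith
    have hA' : (A : ℝ) ≤ -1 := by exact_mod_cast (by omega : A ≤ -1)
    have hB' : (0 : ℝ) ≤ B := by exact_mod_cast hB
    refine le_trans ?_ (neg_le_abs _)
    nlinarith
  · have hB : B ≤ 0 := by
      by_contra! hB
      nlinarith
    have hA' : (1 : ℝ) ≤ A := by exact_mod_cast (by omega : 1 ≤ A)
    have hB' : (B : ℝ) ≤ 0 := by exact_mod_cast hB
    refine le_trans ?_ (le_abs_self _)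
    nlinarith

theorem convergent_error_rec {H a : ℕ → ℕ} {P : ℕ → ℤ} {θ : ℝ}
    (hH : ∀ n, H (n + 2) = a (n + 1) * H (n + 1) + H n)
    (hP : ∀ n, P (n + 2) = a (n + 1) * P (n + 1) + P n)
    (hθ : ∀ n, 0 < (-1) ^ n * (H n * θ - P n)) (n : ℕ) :
    |H (n + 2) * θ - P (n + 2)| = |H n * θ - P n| - a (n + 1) * |H (n + 1) * θ - P (n + 1)| := by
  have habs : ∀ n, |H n * θ - P n| = (-1) ^ n * (H n * θ - P n) := fun n => by
    rw [← abs_of_pos (hθ n), abs_mul, abs_pow, abs_neg, abs_one, one_pow, one_mul]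
  rw [habs, habs, habs, hH, hP]
  push_cast
  ring

theorem irrational_of_convergents {H : ℕ → ℕ} {P : ℕ → ℤ} {θ : ℝ}
    (hdet : ∀ n, P (n + 1) * H n - P n * H (n + 1) = (-1) ^ n)
    (hθ : ∀ n, 0 < (-1) ^ n * (H n * θ - P n)) (hH : Tendsto H atTop atTop) :
    Irrational θ := by
  rintro ⟨r, rfl⟩
  obtain ⟨n, hn⟩ := ((tendsto_add_atTop_iff_nat 1).2 hH |>.eventually_gt_atTop r.den).exists
  have h := convergent_best_approx hdet hθ n r.den r.num (by simp) (by simpa using hn)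
  have : ((r.den : ℤ) : ℝ) * (r : ℝ) - r.num = 0 := by
    rw [sub_eq_zero]
    exact_mod_cast Rat.den_mul_eq_num r
  rw [this, abs_zero] at h
  have h0 := abs_nonpos_iff.1 h
  simpa [h0] using hθ n

theorem abs_angle_sub_convergent_le {H : ℕ → ℕ} {P : ℕ → ℤ} {θ : ℝ} (hpos : ∀ n, 0 < H n)
    (hdet : ∀ n, P (n + 1) * H n - P n * H (n + 1) = (-1) ^ n)
    (hθ : ∀ n, 0 < (-1) ^ n * (H n * θ - P n)) :
    |θ - P 1 / H 1| ≤ 1 / H 2 := by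
  have h1 := hθ 1
  have h2 := hθ 2
  have hd : (P 2 * H 1 - P 1 * H 2 : ℝ) = -1 := by exact_mod_cast hdet 1
  have hH1 : (1 : ℝ) ≤ H 1 := by exact_mod_cast hpos 1
  have hH2 : (0 : ℝ) < H 2 := by exact_mod_cast hpos 2
  have : θ - P 1 / H 1 = (H 1 * θ - P 1) / H 1 := by field_simp
  rw [this, abs_div, abs_of_pos (by linarith : (0 : ℝ) < H 1), div_le_div_iff₀ (by linarith) hH2,
    abs_of_neg (by linarith)]
  nlinarith

/-- Any finite measure on an uncountable standard Borel space has an uncountable null set. -/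
theorem exists_null_not_countable {X : Type*} [MeasurableSpace X] [StandardBorelSpace X]
    (hX : ¬ Countable X) (μ : Measure X) [IsFiniteMeasure μ] :
    ∃ s, MeasurableSet s ∧ μ s = 0 ∧ ¬ s.Countable := by
  have hR : ¬ Countable ℝ := not_countable
  have hRR : ¬ Countable (ℝ × ℝ) := not_countable
  let e := PolishSpace.measurableEquivOfNotCountable hX hRR
  let A : ℝ → Set X := fun r => (fun x => (e x).1) ⁻¹' {r}
  have hA : ∀ r, MeasurableSet (A r) := fun r =>
    (measurable_fst.comp e.measurable) (measurableSet_singleton r)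
  have hdisj : Pairwise (Function.onFun Disjoint A) := fun r s hrs =>
    Disjoint.preimage _ (by simpa using hrs)
  have hcount := Measure.countable_meas_pos_of_disjoint_iUnion (μ := μ) hA hdisj
  obtain ⟨r, hr⟩ : ∃ r, r ∉ {r | 0 < μ (A r)} := by
    by_contra! h
    exact hR (countable_univ_iff.1 (hcount.mono fun r _ => h r))
  refine ⟨A r, hA r, by simpa using hr, fun hc => ?_⟩
  have hinj : Function.Injective fun t : ℝ => e.symm (r, t) := fun t t' h => by simpa using h
  have hmem : ∀ t : ℝ, e.symm (r, t) ∈ A r := fun t => by simp [A]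
  have : Countable (A r) := hc.to_subtype
  exact hR (Function.Injective.countable (f := fun t => (⟨e.symm (r, t), hmem t⟩ : A r))
    fun t t' h => hinj (Subtype.ext_iff.1 h))

theorem not_countable_of_nullSingletonClass {X : Type*} [MeasurableSpace X] (μ : Measure X) [NullSingletonClass μ]
    [NeZero μ] : ¬ Countable X := fun _ =>
  NeZero.ne μ (Measure.measure_univ_eq_zero.1 (countable_univ.measure_zero μ))

/-- An almost everywhere injective measure-preserving map between atomless standard Borel spaces
agrees almost everywhere with a measurable equivalence. -/
theorem exists_measurableEquiv_ae_eq {X Y : Type*} [MeasurableSpace X] [MeasurableSpace Y]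
    [StandardBorelSpace X] [StandardBorelSpace Y] {μ : Measure X} {ν : Measure Y}
    [IsProbabilityMeasure μ] [IsProbabilityMeasure ν] [NullSingletonClass μ] (hY : ¬ Countable Y)
    {f : X → Y} (hf : MeasurePreserving f μ ν) {S : Set X} (hS : S ∈ ae μ) (hinj : InjOn f S) :
    ∃ Φ : X ≃ᵐ Y, Φ =ᵐ[μ] f := by
  classical
  obtain ⟨C, hCm, hC0, hC⟩ := exists_null_not_countable (not_countable_of_nullSingletonClass μ) μ
  obtain ⟨D, hDm, hD0, hD⟩ := exists_null_not_countable hY ν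
  let A := ((toMeasurable μ Sᶜ)ᶜ ∩ Cᶜ) ∩ f ⁻¹' Dᶜ
  have hAm : MeasurableSet A := (((measurableSet_toMeasurable _ _).compl).inter hCm.compl).inter
    (hf.measurable hDm.compl)
  have hAae : A ∈ ae μ := by
    refine inter_mem (inter_mem ?_ ?_) ?_
    · rw [compl_mem_ae_iff, measure_toMeasurable]
      exact hS
    · rwa [compl_mem_ae_iff]
    · rwa [preimage_compl, compl_mem_ae_iff, hf.measure_preimage hDm.nullMeasurableSet]
  have hAS : A ⊆ S := fun x hx => by
    by_contra h
    exact hx.1.1 (subset_toMeasurable _ _ h)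
  have : StandardBorelSpace A := hAm.standardBorel
  have hemb : MeasurableEmbedding (A.domRestrict f) :=
    (hf.measurable.comp measurable_subtype_coe).measurableEmbedding
      (injOn_iff_injective.1 (hinj.mono hAS))
  have hBm : MeasurableSet (range (A.domRestrict f)) := hemb.measurableSet_range
  have : StandardBorelSpace (Aᶜ : Set X) := hAm.compl.standardBorel
  have : StandardBorelSpace ((range (A.domRestrict f))ᶜ : Set Y) := hBm.compl.standardBorel
  have hA' : ¬ Countable (Aᶜ : Set X) := fun h => hC ((countable_coe_iff.1 h).mono
    fun x hx => mem_compl fun hxA : x ∈ A => hxA.1.2 hx)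
  have hB' : ¬ Countable ((range (A.domRestrict f))ᶜ : Set Y) := fun h => hD
    ((countable_coe_iff.1 h).mono (by rintro y hy ⟨⟨x, hx⟩, rfl⟩; exact hx.2 hy))
  refine ⟨(MeasurableEquiv.sumCompl hAm).symm.trans ((MeasurableEquiv.sumCongr hemb.equivRange
    (PolishSpace.measurableEquivOfNotCountable hA' hB')).trans
      (MeasurableEquiv.sumCompl hBm)), ?_⟩
  filter_upwards [hAae] with x hx
  have h1 : (MeasurableEquiv.sumCompl hAm).symm x = Sum.inl ⟨x, hx⟩ := by
    rw [MeasurableEquiv.symm_apply_eq]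
    rfl
  simp only [MeasurableEquiv.trans_apply, h1]
  change ((hemb.equivRange ⟨x, hx⟩ : range (A.domRestrict f)) : Y) = f x
  rw [hemb.equivRange_apply]
  rfl

/-- Unique ergodicity of irrational rotations. -/
theorem eq_volume_of_map_add_irrational {θ : ℝ} (hθ : Irrational θ)
    (ν : Measure (AddCircle (1 : ℝ))) [IsProbabilityMeasure ν]
    (hν : ν.map (fun x => (θ : AddCircle (1 : ℝ)) + x) = ν) : ν = volume := by
  have hint : ∀ (g : BoundedContinuousFunction (AddCircle (1 : ℝ)) ℝ) (t : AddCircle (1 : ℝ)),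
      ∫ x, g (t + x) ∂ν = ∫ x, g x ∂ν := by
    intro g
    have hcont : Continuous fun t => ∫ x, g (t + x) ∂ν := by
      refine continuous_of_dominated (bound := fun _ => ‖g‖) ?_ ?_ (integrable_const _) ?_
      · exact fun t => (g.continuous.comp (continuous_const.add continuous_id)).aestronglyMeasurable
      · exact fun t => Eventually.of_forall fun x => g.norm_coe_le_norm _
      · exact Eventually.of_forall fun x => g.continuous.comp (continuous_id.add continuous_const)
    have hstep : ∀ t : AddCircle (1 : ℝ), ∫ x, g (t + θ + x) ∂ν = ∫ x, g (t + x) ∂ν := by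
      intro t
      conv_rhs => rw [← hν]
      rw [integral_map (measurable_const_add _).aemeasurable
        (by fun_prop : Continuous fun x => g (t + x)).aestronglyMeasurable]
      simp only [add_assoc]
    have hdense : DenseRange (· • (θ : AddCircle (1 : ℝ)) : ℤ → AddCircle (1 : ℝ)) :=
      AddCircle.denseRange_zsmul_coe_iff.2 (by simpa using hθ)
    refine congrFun (hdense.equalizer hcont continuous_const (funext fun n => ?_))
    simp only [Function.comp_apply]
    induction n with
    | zero => simp
    | succ n ih => rw [add_zsmul, one_zsmul, hstep, ih]
    | pred n ih =>
      rw [← ih, ← hstep, sub_zsmul, one_zsmul, neg_add_cancel_right]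
  have hinv : ν.IsAddLeftInvariant := ⟨fun t => by
    have : IsProbabilityMeasure (ν.map (t + ·)) :=
      Measure.isProbabilityMeasure_map (by fun_prop)
    refine ext_of_forall_integral_eq_of_IsFiniteMeasure fun g => ?_
    rw [integral_map (by fun_prop) g.continuous.aestronglyMeasurable, hint]⟩
  have : ν.IsAddHaarMeasure := Measure.isAddHaarMeasure_of_isCompact_nonempty_interior ν univ
    isCompact_univ (by simp) (by simp) (by simp)
  have : IsProbabilityMeasure (volume : Measure (AddCircle (1 : ℝ))) := ⟨by simp⟩
  exact Measure.isAddHaarMeasure_eq_of_isProbabilityMeasure _ _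

/-- A system with an almost everywhere injective eigenfunction of irrational eigenvalue is
conjugate to the corresponding rotation. -/
theorem conjugate_rot_of_injOn {X : Type} [MeasurableSpace X] [StandardBorelSpace X]
    {μ : Measure X} [IsProbabilityMeasure μ] [NullSingletonClass μ] {T : X ≃ᵐ X}
    (hT : MeasurePreserving T μ μ) {θ : ℝ} (hθ : Irrational θ) {f : X → AddCircle (1 : ℝ)}
    (hf : Measurable f) (hfT : ∀ᵐ x ∂μ, f (T x) = θ + f x) {S : Set X} (hS : S ∈ ae μ)
    (hinj : InjOn f S) :
    ∃ Ψ : AddCircle (1 : ℝ) ≃ᵐ X, MeasurePreserving Ψ volume μ ∧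
      ∀ᵐ x ∂(volume : Measure (AddCircle (1 : ℝ))),
        Ψ (MeasurableEquiv.addLeft (θ : AddCircle (1 : ℝ)) x) = T (Ψ x) := by
  have : IsProbabilityMeasure (volume : Measure (AddCircle (1 : ℝ))) := ⟨by simp⟩
  have : IsProbabilityMeasure (μ.map f) := Measure.isProbabilityMeasure_map hf.aemeasurable
  have hmap : μ.map f = volume := by
    refine eq_volume_of_map_add_irrational hθ _ ?_
    rw [Measure.map_map (by fun_prop) hf]
    calc μ.map ((fun x => (θ : AddCircle (1 : ℝ)) + x) ∘ f) = μ.map (f ∘ T) :=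
          Measure.map_congr (hfT.mono fun x hx => hx.symm)
      _ = μ.map f := by rw [← Measure.map_map hf T.measurable, hT.map_eq]
  have hY : ¬ Countable (AddCircle (1 : ℝ)) := by
    rw [(AddCircle.equivIco (1 : ℝ) 0).countable_iff, countable_coe_iff, Cardinal.Real.Ico_countable_iff]
    simp
  obtain ⟨Φ, hΦ⟩ := exists_measurableEquiv_ae_eq hY ⟨hf, hmap⟩ hS hinj
  have hΦm : MeasurePreserving Φ μ volume := ⟨Φ.measurable, by rw [Measure.map_congr hΦ, hmap]⟩
  refine ⟨Φ.symm, hΦm.symm, ?_⟩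
  have h1 : ∀ᵐ x ∂μ, Φ (T x) = θ + Φ x := by
    filter_upwards [hΦ, hT.quasiMeasurePreserving.ae hΦ, hfT] with x hx hTx h
    rw [hTx, h, hx]
  filter_upwards [hΦm.symm.quasiMeasurePreserving.ae h1] with y hy
  rw [MeasurableEquiv.symm_apply_eq, hy, MeasurableEquiv.apply_symm_apply]
  rfl

section Towers

variable {X : Type} [MeasurableSpace X] {T : X ≃ᵐ X} {p : ℕ → CSParam} {B : ℕ → Set X}
  {Bsub : ℕ → ℕ → Set X}

theorem mem_towerUnion {n : ℕ} {x : X} :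
    x ∈ towerUnion T p B n ↔ ∃ k < heights p n, x ∈ (⇑T)^[k] '' B n := by
  simp [towerUnion]

theorem colStart_eq (hσ : ∀ n, ∀ j < (p n).q, (p n).σ j = 0) {n i : ℕ} (hi : i < (p n).q) :
    colStart p n i = i * heights p n := by
  rw [colStart, Finset.sum_eq_zero, zero_add]
  exact fun j hj => hσ n j (by have := Finset.mem_range.1 hj; omega)

theorem digit_lt_heights {n i k : ℕ} (hi : i < (p n).q) (hk : k < heights p n) :
    i * heights p n + k < (p n).q * heights p n := by
  nlinarith

theorem measurableSet_iterate_image (T : X ≃ᵐ X) {s : Set X} (hs : MeasurableSet s) (k : ℕ) :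
    MeasurableSet ((⇑T)^[k] '' s) := by
  induction k with
  | zero => simpa
  | succ k ih =>
    rw [Function.iterate_succ', image_comp]
    exact (MeasurableEquiv.measurableSet_image T).2 ih

namespace IsCuttingStacking

theorem level_unique (hCS : IsCuttingStacking T p B Bsub) {n k l : ℕ} {x : X}
    (hk : k < heights p n) (hl : l < heights p n) (hxk : x ∈ (⇑T)^[k] '' B n)
    (hxl : x ∈ (⇑T)^[l] '' B n) : k = l := by
  by_contra h
  exact disjoint_left.1 (hCS.disj_levels n k hk l hl h) hxk hxl

theorem exists_digit (hCS : IsCuttingStacking T p B Bsub)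
    (hσ : ∀ n, ∀ j < (p n).q, (p n).σ j = 0) {n k : ℕ} {x : X}
    (hk : k < heights p n) (hx : x ∈ (⇑T)^[k] '' B n) :
    ∃ i < (p n).q, i * heights p n + k < heights p (n + 1) ∧
      x ∈ (⇑T)^[i * heights p n + k] '' B (n + 1) ∧
      (⇑T)^[i * heights p n + k] '' B (n + 1) ⊆ (⇑T)^[k] '' B n := by
  obtain ⟨b, hb, rfl⟩ := hx
  have hb' := hb
  rw [hCS.union_sub] at hb'
  simp only [Finset.mem_range, mem_iUnion, exists_prop] at hb'
  obtain ⟨i, hi, hbi⟩ := hb'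
  have hsub := hCS.subcolumn n i hi k hk
  rw [colStart_eq hσ hi] at hsub
  refine ⟨i, hi, (digit_lt_heights hi hk).trans_le (by simp [heights]), ?_, ?_⟩
  · rw [hsub]
    exact mem_image_of_mem _ hbi
  · rw [hsub]
    refine image_mono ?_
    rw [hCS.union_sub]
    exact subset_biUnion_of_mem (u := fun i => Bsub n i) (by simpa using hi)

theorem exists_level_of_le (hCS : IsCuttingStacking T p B Bsub)
    (hσ : ∀ n, ∀ j < (p n).q, (p n).σ j = 0) {n m : ℕ} (hnm : n ≤ m) {j : ℕ} {x : X}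
    (hj : j < heights p n) (hx : x ∈ (⇑T)^[j] '' B n) :
    ∃ k < heights p m, x ∈ (⇑T)^[k] '' B m ∧ (⇑T)^[k] '' B m ⊆ (⇑T)^[j] '' B n := by
  induction m, hnm using Nat.le_induction with
  | base => exact ⟨j, hj, hx, subset_rfl⟩
  | succ m _ ih =>
    obtain ⟨k, hk, hxk, hsub⟩ := ih
    obtain ⟨i, _, hlt, hmem, hsub'⟩ := hCS.exists_digit hσ hk hxk
    exact ⟨_, hlt, hmem, hsub'.trans hsub⟩

theorem towerUnion_mono (hCS : IsCuttingStacking T p B Bsub)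
    (hσ : ∀ n, ∀ j < (p n).q, (p n).σ j = 0) : Monotone (towerUnion T p B) := by
  intro n m hnm x hx
  rw [mem_towerUnion] at hx ⊢
  obtain ⟨j, hj, hx⟩ := hx
  obtain ⟨k, hk, hxk, _⟩ := hCS.exists_level_of_le hσ hnm hj hx
  exact ⟨k, hk, hxk⟩

end IsCuttingStacking

theorem TowersGenerate.exists_separating [StandardBorelSpace X] {μ : Measure X}
    (hgen : TowersGenerate μ T p B) :
    ∃ S ∈ ae μ, ∀ x ∈ S, ∀ y ∈ S,
      (∀ n, ∀ k < heights p n, x ∈ (⇑T)^[k] '' B n ↔ y ∈ (⇑T)^[k] '' B n) → x = y := by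
  obtain ⟨A, hAm, hA⟩ := exists_seq_separating X MeasurableSet.univ univ
  choose A' hA' hAA' using fun n => hgen (A n) (hAm n)
  refine ⟨(⋃ n, symmDiff (A n) (A' n))ᶜ, ?_, fun x hx y hy hxy => hA x trivial y trivial fun n => ?_⟩
  · rw [compl_mem_ae_iff, measure_iUnion_null_iff]
    exact hAA'
  · have hiff : ∀ z ∈ (⋃ n, symmDiff (A n) (A' n))ᶜ, z ∈ A n ↔ z ∈ A' n := fun z hz => by
      rw [mem_compl_iff, mem_iUnion, not_exists] at hz
      have := hz n
      rw [mem_symmDiff] at this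
      tauto
    rw [hiff x hx, hiff y hy]
    refine MeasurableSpace.generateFrom_induction _ (fun s _ => x ∈ s ↔ y ∈ s) ?_ ?_ ?_ ?_ _ (hA' n)
    · rintro s ⟨n, k, hk, rfl⟩ _
      exact hxy n k hk
    · simp
    · exact fun s _ h => not_congr h
    · intro s _ h
      simp only [mem_iUnion]
      exact exists_congr h

theorem TowersGenerate.iUnion_towerUnion_mem_ae [StandardBorelSpace X] {μ : Measure X}
    [NullSingletonClass μ] (hgen : TowersGenerate μ T p B) :
    ⋃ n, towerUnion T p B n ∈ ae μ := by
  obtain ⟨S, hS, hsep⟩ := hgen.exists_separating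
  have hsub : (S \ ⋃ n, towerUnion T p B n).Subsingleton := by
    rintro x ⟨hxS, hx⟩ y ⟨hyS, hy⟩
    refine hsep x hxS y hyS fun n k hk => iff_of_false (fun h => hx ?_) fun h => hy ?_
    · exact mem_iUnion.2 ⟨n, mem_towerUnion.2 ⟨k, hk, h⟩⟩
    · exact mem_iUnion.2 ⟨n, mem_towerUnion.2 ⟨k, hk, h⟩⟩
  filter_upwards [hS, compl_mem_ae_iff.2 (hsub.measure_zero μ)] with x hx hx'
  by_contra h
  exact hx' ⟨hx, h⟩

/-- The function equal to `k • α` on the `k`-th level of the `n`-th tower and vanishing outside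
the tower. -/
noncomputable def towerPhase (T : X ≃ᵐ X) (p : ℕ → CSParam) (B : ℕ → Set X)
    (α : AddCircle (1 : ℝ)) (n : ℕ) (x : X) : AddCircle (1 : ℝ) :=
  ∑ k ∈ Finset.range (heights p n), ((⇑T)^[k] '' B n).indicator (fun _ => k • α) x

theorem measurable_towerPhase (hB : ∀ n, MeasurableSet (B n)) (α : AddCircle (1 : ℝ)) (n : ℕ) :
    Measurable (towerPhase T p B α n) :=
  Finset.measurable_fun_sum _ fun k _ =>
    measurable_const.indicator (measurableSet_iterate_image T (hB n) k)

theorem IsCuttingStacking.towerPhase_eq (hCS : IsCuttingStacking T p B Bsub)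
    (α : AddCircle (1 : ℝ)) {n k : ℕ} {x : X} (hk : k < heights p n)
    (hx : x ∈ (⇑T)^[k] '' B n) : towerPhase T p B α n x = k • α := by
  rw [towerPhase, Finset.sum_eq_single k, indicator_of_mem hx]
  · intro l hl hlk
    exact indicator_of_notMem (fun hxl =>
      hlk (hCS.level_unique (Finset.mem_range.1 hl) hk hxl hx)) _
  · exact fun h => absurd (Finset.mem_range.2 hk) h

theorem IsCuttingStacking.towerPhase_succ (hCS : IsCuttingStacking T p B Bsub)
    (hσ : ∀ n, ∀ j < (p n).q, (p n).σ j = 0) (α : AddCircle (1 : ℝ)) {n : ℕ} {x : X}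
    (hx : x ∈ towerUnion T p B n) :
    ∃ i < (p n).q, towerPhase T p B α (n + 1) x =
      towerPhase T p B α n x + i • heights p n • α := by
  obtain ⟨k, hk, hxk⟩ := mem_towerUnion.1 hx
  obtain ⟨i, hi, hlt, hmem, _⟩ := hCS.exists_digit hσ hk hxk
  refine ⟨i, hi, ?_⟩
  rw [hCS.towerPhase_eq α hk hxk, hCS.towerPhase_eq α hlt hmem, add_smul, mul_smul, add_comm]

variable {α : AddCircle (1 : ℝ)} {d : ℕ → ℝ}

theorem IsCuttingStacking.exists_tendsto_towerPhase (hCS : IsCuttingStacking T p B Bsub)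
    (hσ : ∀ n, ∀ j < (p n).q, (p n).σ j = 0) (hd : ∀ n, 0 < d n)
    (hrec : ∀ n, d (n + 2) = d n - (p (n + 1)).q * d (n + 1))
    (hα : ∀ n, ‖heights p (n + 1) • α‖ ≤ d (n + 1)) {x : X}
    (hx : x ∈ ⋃ n, towerUnion T p B n) :
    ∃ l, Tendsto (fun n => towerPhase T p B α n x) atTop (𝓝 l) := by
  obtain ⟨N, hN⟩ := mem_iUnion.1 hx
  have hsum : Summable fun n => d n - d (n + 2) := by
    have hnn : ∀ n, 0 ≤ d n - d (n + 2) := fun n => by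
      rw [hrec]
      have := mul_nonneg (Nat.cast_nonneg (α := ℝ) (p (n + 1)).q) (hd (n + 1)).le
      linarith
    refine summable_of_sum_range_le (c := d 0 + d 1) hnn fun n => ?_
    have : ∑ i ∈ Finset.range n, (d i - d (i + 2)) = d 0 + d 1 - d n - d (n + 1) := by
      induction n with
      | zero => simp
      | succ n ih => rw [Finset.sum_range_succ, ih]; ring
    linarith [hd n, hd (n + 1)]
  have hcauchy : CauchySeq fun n => towerPhase T p B α (n + (N + 1)) x := by
    refine cauchySeq_of_dist_le_of_summable _ (fun n => ?_)
      (hsum.comp_injective (add_left_injective N))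
    obtain ⟨i, hi, h⟩ := hCS.towerPhase_succ hσ α
      (hCS.towerUnion_mono hσ (by omega : N ≤ n + (N + 1)) hN)
    have : n + 1 + (N + 1) = n + (N + 1) + 1 := by ring
    rw [this, h, dist_self_add_right]
    have h1 : n + (N + 1) = n + N + 1 := by ring
    have h2 := hrec (n + N)
    rw [h1] at hi ⊢
    simp only [Function.comp_apply]
    calc ‖i • heights p (n + N + 1) • α‖ ≤ i * ‖heights p (n + N + 1) • α‖ := norm_nsmul_le
      _ ≤ (p (n + N + 1)).q * d (n + N + 1) :=
        mul_le_mul (by exact_mod_cast hi.le) (hα _) (norm_nonneg _) (Nat.cast_nonneg _)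
      _ = d (n + N) - d (n + N + 2) := by rw [h2]; ring
  obtain ⟨l, hl⟩ := cauchySeq_tendsto_of_complete hcauchy
  exact ⟨l, (tendsto_add_atTop_iff_nat (N + 1)).1 hl⟩

/-- Distinct levels of a tower are separated by the limit of the phases. -/
theorem IsCuttingStacking.limit_ne_of_level_ne (hCS : IsCuttingStacking T p B Bsub)
    (hσ : ∀ n, ∀ j < (p n).q, (p n).σ j = 0) (hd : ∀ n, 0 < d n)
    (hrec : ∀ n, d (n + 2) = d n - (p (n + 1)).q * d (n + 1))
    (hα : ∀ n, ‖heights p (n + 1) • α‖ ≤ d (n + 1))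
    (hbest : ∀ (n : ℕ) (j : ℤ), j ≠ 0 → |j| < heights p (n + 1) → d n ≤ ‖j • α‖)
    {x y : X} {u v : AddCircle (1 : ℝ)}
    (hu : Tendsto (fun n => towerPhase T p B α n x) atTop (𝓝 u))
    (hv : Tendsto (fun n => towerPhase T p B α n y) atTop (𝓝 v)) {m k l : ℕ}
    (hk : k < heights p (m + 1)) (hl : l < heights p (m + 1)) (hkl : k ≠ l)
    (hx : x ∈ (⇑T)^[k] '' B (m + 1)) (hy : y ∈ (⇑T)^[l] '' B (m + 1)) : u ≠ v := by
  set D : ℕ → AddCircle (1 : ℝ) := fun n => towerPhase T p B α n x - towerPhase T p B α n y with hD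
  have hDm : d m ≤ ‖D (m + 1)‖ := by
    simp only [hD]
    rw [hCS.towerPhase_eq α hk hx, hCS.towerPhase_eq α hl hy, ← natCast_zsmul, ← natCast_zsmul,
      ← sub_smul]
    exact hbest m _ (by omega) (by rw [abs_lt]; omega)
  have hstep : ∀ n, m ≤ n → ‖D (n + 2) - D (n + 1)‖ ≤ d n - d (n + 1) - d (n + 2) := by
    intro n hn
    have hmono := hCS.towerUnion_mono hσ (by omega : m + 1 ≤ n + 1)
    obtain ⟨i, hi, hix⟩ := hCS.towerPhase_succ hσ α (hmono (mem_towerUnion.2 ⟨k, hk, hx⟩))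
    obtain ⟨i', hi', hiy⟩ := hCS.towerPhase_succ hσ α (hmono (mem_towerUnion.2 ⟨l, hl, hy⟩))
    have : D (n + 2) - D (n + 1) = ((i : ℤ) - i') • heights p (n + 1) • α := by
      simp only [hD]
      rw [hix, hiy, sub_zsmul, natCast_zsmul, natCast_zsmul]
      abel
    have habs : |(i : ℤ) - i'| ≤ (p (n + 1)).q - 1 := by rw [abs_le]; omega
    have habs' : ‖(i : ℤ) - i'‖ ≤ (p (n + 1)).q - 1 := by
      rw [Int.norm_eq_abs]
      exact_mod_cast habs
    rw [this]
    calc ‖((i : ℤ) - i') • heights p (n + 1) • α‖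
        ≤ ‖(i : ℤ) - i'‖ * ‖heights p (n + 1) • α‖ := norm_zsmul_le _ _
      _ ≤ ((p (n + 1)).q - 1) * d (n + 1) :=
        mul_le_mul habs' (hα n) (norm_nonneg _) ((norm_nonneg _).trans habs')
      _ = d n - d (n + 1) - d (n + 2) := by rw [hrec]; ring
  have hbound : ∀ t, ‖D (m + 2 + t) - D (m + 1)‖ ≤ d m - d (m + 2) - d (m + 1 + t) := by
    intro t
    induction t with
    | zero =>
      have := hstep m le_rfl
      simp only [add_zero]
      linarith
    | succ t ih =>
      have h1 := hstep (m + 1 + t) (by omega)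
      have h2 : m + 2 + (t + 1) = m + 1 + t + 2 := by ring
      have h3 : m + 2 + t = m + 1 + t + 1 := by ring
      rw [h3] at ih
      rw [h2, ← add_assoc (m + 1) t 1]
      have h4 := norm_sub_le_norm_sub_add_norm_sub (D (m + 1 + t + 2)) (D (m + 1 + t + 1)) (D (m + 1))
      linarith [hd (m + 1 + t + 2)]
  have hlim : Tendsto (fun t => ‖D (t + (m + 2)) - D (m + 1)‖) atTop (𝓝 ‖u - v - D (m + 1)‖) :=
    (((tendsto_add_atTop_iff_nat (m + 2)).2 (hu.sub hv)).sub_const _).norm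
  have hle : ‖u - v - D (m + 1)‖ ≤ d m - d (m + 2) :=
    le_of_tendsto' hlim fun t => by
      rw [add_comm t]
      linarith [hbound t, hd (m + 1 + t)]
  rintro rfl
  rw [sub_self, zero_sub, norm_neg] at hle
  linarith [hd (m + 2)]

theorem IsCuttingStacking.towerPhase_apply (hCS : IsCuttingStacking T p B Bsub)
    (hσ : ∀ n, ∀ j < (p n).q, (p n).σ j = 0)
    {n : ℕ} (hheight : (p n).q * heights p n < heights p (n + 1)) {x : X}
    (hx : x ∈ towerUnion T p B n) :
    towerPhase T p B α (n + 1) (T x) = α + towerPhase T p B α (n + 1) x := by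
  obtain ⟨k, hk, hxk⟩ := mem_towerUnion.1 hx
  obtain ⟨i, hi, hlt, hmem, _⟩ := hCS.exists_digit hσ hk hxk
  have hTx : T x ∈ (⇑T)^[i * heights p n + k + 1] '' B (n + 1) := by
    rw [Function.iterate_succ', image_comp]
    exact mem_image_of_mem _ hmem
  rw [hCS.towerPhase_eq α hlt hmem,
    hCS.towerPhase_eq α ((Nat.succ_le_of_lt (digit_lt_heights hi hk)).trans_lt hheight) hTx,
    succ_nsmul']

/-- A rank-one system whose spacers are all placed on top of the towers and whose heights are
denominators of best approximations of `θ` is conjugate to the rotation of angle `θ`. -/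
theorem IsRankOneWith.conjugate_rot [StandardBorelSpace X] {μ : Measure X}
    [IsProbabilityMeasure μ] [NullSingletonClass μ] (hT : IsRankOneWith μ T p) {θ : ℝ}
    (hθ : Irrational θ) (hσ : ∀ n, ∀ j < (p n).q, (p n).σ j = 0)
    (hheight : ∀ n, (p (n + 1)).q * heights p (n + 1) < heights p (n + 2)) (hd : ∀ n, 0 < d n)
    (hrec : ∀ n, d (n + 2) = d n - (p (n + 1)).q * d (n + 1))
    (happrox : ∀ n, ‖heights p (n + 1) • (θ : AddCircle (1 : ℝ))‖ ≤ d (n + 1))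
    (hbest : ∀ (n : ℕ) (j : ℤ), j ≠ 0 → |j| < heights p (n + 1) →
      d n ≤ ‖j • (θ : AddCircle (1 : ℝ))‖) :
    Conjugate (volume : Measure (AddCircle (1 : ℝ))) (rot θ) μ T := by
  obtain ⟨hmp, -, B, Bsub, hCS, hgen⟩ := hT
  have hX := hgen.iUnion_towerUnion_mem_ae
  obtain ⟨f, hf, hlim⟩ := measurable_limit_of_tendsto_metrizable_ae (μ := μ) (L := atTop)
    (fun n => (measurable_towerPhase (T := T) (p := p) hCS.meas_base (θ : AddCircle (1 : ℝ))
      n).aemeasurable)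
    (mem_of_superset hX fun x hx => hCS.exists_tendsto_towerPhase hσ hd hrec happrox hx)
  obtain ⟨S, hS, hsep⟩ := hgen.exists_separating
  refine conjugate_rot_of_injOn hmp hθ hf ?_ (inter_mem hS (inter_mem hX hlim)) ?_
  · filter_upwards [hX, hlim, hmp.quasiMeasurePreserving.ae hlim] with x hx h hTx
    obtain ⟨N, hN⟩ := mem_iUnion.1 hx
    refine tendsto_nhds_unique hTx ((h.const_add _).congr' ?_)
    filter_upwards [eventually_ge_atTop (N + 2)] with n hn
    obtain ⟨n, rfl⟩ := Nat.exists_eq_add_of_le' (by omega : 2 ≤ n)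
    exact (hCS.towerPhase_apply hσ (hheight n) (hCS.towerUnion_mono hσ (by omega) hN)).symm
  · rintro x ⟨hxS, hxX, hx⟩ y ⟨hyS, hyX, hy⟩
    contrapose!
    intro hxy
    obtain ⟨n, k, hk, hne⟩ : ∃ n, ∃ k < heights p n,
        ¬ (x ∈ (⇑T)^[k] '' B n ↔ y ∈ (⇑T)^[k] '' B n) := by
      by_contra! h
      exact hxy (hsep x hxS y hyS h)
    obtain ⟨N, hN⟩ := mem_iUnion.1 hxX
    obtain ⟨N', hN'⟩ := mem_iUnion.1 hyX
    let m := N + N' + n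
    obtain ⟨a, ha, hxa⟩ := mem_towerUnion.1
      (hCS.towerUnion_mono hσ (by omega : N ≤ m + 1) hN)
    obtain ⟨b, hb, hyb⟩ := mem_towerUnion.1
      (hCS.towerUnion_mono hσ (by omega : N' ≤ m + 1) hN')
    refine hCS.limit_ne_of_level_ne hσ hd hrec happrox hbest hx hy ha hb ?_ hxa hyb
    rintro rfl
    refine hne ⟨fun h => ?_, fun h => ?_⟩
    · obtain ⟨c, hc, hxc, hsub⟩ := hCS.exists_level_of_le hσ (by omega : n ≤ m + 1) hk h
      exact hsub (hCS.level_unique hc ha hxc hxa ▸ hyb)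
    · obtain ⟨c, hc, hyc, hsub⟩ := hCS.exists_level_of_le hσ (by omega : n ≤ m + 1) hk h
      exact hsub (hCS.level_unique hc ha hyc hyb ▸ hxa)

end Towers

theorem UnitAddCircle.norm_nsmul_coe_le (θ : ℝ) (n : ℕ) (m : ℤ) :
    ‖n • (θ : AddCircle (1 : ℝ))‖ ≤ |n * θ - m| := by
  rw [← AddCircle.coe_nsmul, UnitAddCircle.norm_eq, nsmul_eq_mul]
  exact round_le _ _

theorem UnitAddCircle.exists_norm_zsmul_coe (θ : ℝ) (j : ℤ) :
    ∃ m : ℤ, ‖j • (θ : AddCircle (1 : ℝ))‖ = |j * θ - m| := by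
  rw [← AddCircle.coe_zsmul, UnitAddCircle.norm_eq, zsmul_eq_mul]
  exact ⟨_, rfl⟩

/-- Every nonempty open set of reals contains a neighbourhood of a reduced fraction `c / N` with
`3 ≤ N`. The integer `M` is an inverse of `c` modulo `N`. -/
theorem exists_reduced_fraction_mem {V : Set ℝ} (hV : IsOpen V) (hne : V.Nonempty) :
    ∃ (N M K : ℕ) (c e : ℤ), 3 ≤ N ∧ 0 < M ∧ M ≤ N ∧ c * M - e * N = 1 ∧
      ∀ θ : ℝ, K * |θ - c / N| ≤ 1 → θ ∈ V := by
  obtain ⟨r, hr⟩ := (Rat.denseRange_cast (𝕜 := ℝ)).exists_mem_open hV hne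
  obtain ⟨ε, hε, hball⟩ := Metric.isOpen_iff.1 hV r hr
  obtain ⟨t, ht⟩ := exists_nat_gt (2 / ε)
  obtain ⟨a, b, hb, hab⟩ : ∃ (a : ℤ) (b : ℕ), 0 < b ∧ (r : ℝ) = a / b :=
    ⟨r.num, r.den, r.den_pos, by exact_mod_cast (Rat.num_div_den r).symm⟩
  let s := t + 3
  let N := b ^ 2 * s
  have hs : s ≤ N := Nat.le_mul_of_pos_left _ (by positivity)
  have hNz : (N : ℤ) ≠ 0 := by omega
  have hmod := Int.emod_nonneg (1 - a * b * s) hNz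
  have hlt := Int.emod_lt_of_pos (1 - a * b * s) (by omega : (0 : ℤ) < N)
  obtain ⟨M, hM⟩ := Int.eq_ofNat_of_zero_le hmod
  have hdiv := Int.emod_add_mul_ediv (1 - a * b * s) N
  rw [hM] at hlt hdiv
  have hNcast : (N : ℤ) = b ^ 2 * s := by simp [N]
  have hdet : (a * b * s + 1) * M -
      (-(a ^ 2 * s) - (a * b * s + 1) * ((1 - a * b * s) / N)) * N = 1 := by
    linear_combination (a * b * s + 1) * hdiv + a ^ 2 * s * hNcast
  refine ⟨N, M, t, a * b * s + 1, _, by omega, Nat.pos_of_ne_zero ?_, by omega, hdet,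
    fun θ hθ => hball ?_⟩
  · rintro rfl
    rw [Nat.cast_zero, mul_zero, zero_sub, ← neg_mul] at hdet
    have := Int.eq_one_of_mul_eq_one_left (by omega) hdet
    omega
  · have ht0 : (0 : ℝ) < t := (by positivity : (0 : ℝ) < 2 / ε).trans ht
    have hb' : (0 : ℝ) < b := by exact_mod_cast hb
    have hN : (0 : ℝ) < N := by exact_mod_cast (by omega : 0 < N)
    have hclose : ((a * b * s + 1 : ℤ) : ℝ) / N - r = 1 / N := by
      have hs0 : (s : ℝ) ≠ 0 := by positivity
      rw [hab]
      simp only [N]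
      push_cast
      field_simp
      ring
    have h1 : |θ - ((a * b * s + 1 : ℤ) : ℝ) / N| ≤ 1 / t := by
      rw [le_div_iff₀ ht0, mul_comm]
      exact hθ
    have h2 : 1 / (N : ℝ) ≤ 1 / t :=
      one_div_le_one_div_of_le ht0 (by exact_mod_cast (by omega : t ≤ N))
    have h3 : 1 / (t : ℝ) + 1 / t < ε := by
      rw [div_lt_iff₀ hε] at ht
      rw [← add_div, div_lt_iff₀ ht0]
      linarith
    have h4 := abs_sub_le θ (((a * b * s + 1 : ℤ) : ℝ) / N) r
    rw [hclose, abs_of_pos (by positivity : (0 : ℝ) < 1 / N)] at h4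
    rw [Metric.mem_ball, Real.dist_eq]
    linarith

/-- The sequence of heights, with initial value replaced by `M`. -/
def modifiedHeights (M : ℕ) (p : ℕ → CSParam) : ℕ → ℕ
  | 0 => M
  | n + 1 => heights p (n + 1)

/-- The number of spacers at each step: none at first, then the previous modified height. -/
def topSpacerCount (M : ℕ) (p : ℕ → CSParam) : ℕ → ℕ
  | 0 => 0
  | n + 1 => modifiedHeights M p n

/-- Numerators of the convergents with initial values `e`, `c` and partial quotients `a`. -/
def convergentNum (e c : ℤ) (a : ℕ → ℕ) : ℕ → ℤ
  | 0 => e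
  | 1 => c
  | n + 2 => a (n + 1) * convergentNum e c a (n + 1) + convergentNum e c a n

/-- The `n`-th parameter has its spacers on top, in the number prescribed by the continued
fraction algorithm, and its cutting parameter is `N` if `n = 0` and at least `K` otherwise. -/
structure IsContinuedFractionStep (N M K : ℕ) (p : ℕ → CSParam) (n : ℕ) : Prop where
  σ_eq : ∀ i, (p n).σ i = if i = (p n).q then topSpacerCount M p n else 0
  q_zero : n = 0 → (p n).q = N
  le_q : n ≠ 0 → K ≤ (p n).q

theorem heights_congr {p p' : ℕ → CSParam} {n : ℕ} (h : ∀ k < n, p k = p' k) :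
    heights p n = heights p' n := by
  induction n with
  | zero => rfl
  | succ n ih => rw [heights, heights, h n n.lt_succ_self, ih fun k hk => h k (hk.trans n.lt_succ_self)]

theorem topSpacerCount_congr {M : ℕ} {p p' : ℕ → CSParam} {n : ℕ} (h : ∀ k < n, p k = p' k) :
    topSpacerCount M p n = topSpacerCount M p' n := by
  match n with
  | 0 => rfl
  | 1 => rfl
  | n + 2 => exact heights_congr fun k hk => h k (by omega)

theorem heights_add_one_le (p : ℕ → CSParam) (n : ℕ) :
    heights p n + 1 ≤ heights p (n + 1) ∧ n + 1 ≤ heights p n := by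
  induction n with
  | zero =>
    have := (p 0).two_le_q
    simp only [heights]
    omega
  | succ n ih =>
    have := (p (n + 1)).two_le_q
    rw [heights.eq_2 p (n + 1)]
    constructor
    · nlinarith
    · omega

theorem heights_strictMono (p : ℕ → CSParam) : StrictMono (heights p) :=
  strictMono_nat_of_lt_succ fun n => (heights_add_one_le p n).1

theorem listHeight_ofFn (p : ℕ → CSParam) (n : ℕ) :
    listHeight (List.ofFn fun k : Fin n => p k) = heights p n := by
  induction n with
  | zero => simp [listHeight, heights]
  | succ n ih =>
    rw [listHeight] at ih ⊢
    rw [List.ofFn_succ', List.concat_eq_append, List.foldl_append]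
    simp only [Fin.val_castSucc, Fin.val_last, List.foldl_cons, List.foldl_nil, heights]
    rw [ih]

namespace IsContinuedFractionStep

variable {N M K : ℕ} {p p' : ℕ → CSParam} {n : ℕ}

theorem congr (hp : IsContinuedFractionStep N M K p n) (h : ∀ k ≤ n, p k = p' k) :
    IsContinuedFractionStep N M K p' n where
  σ_eq := by
    rw [← h n le_rfl, ← topSpacerCount_congr fun k hk => h k hk.le]
    exact hp.σ_eq
  q_zero := by
    rw [← h n le_rfl]
    exact hp.q_zero
  le_q := by
    rw [← h n le_rfl]
    exact hp.le_q

theorem σtot_eq (hp : IsContinuedFractionStep N M K p n) :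
    (p n).σtot = topSpacerCount M p n := by
  simp [CSParam.σtot, hp.σ_eq]

theorem heights_one (hp : IsContinuedFractionStep N M K p 0) : heights p 1 = N := by
  simp [heights, hp.σtot_eq, topSpacerCount, hp.q_zero]

theorem modifiedHeights_add_two (hp : ∀ n, IsContinuedFractionStep N M K p n) (n : ℕ) :
    modifiedHeights M p (n + 2) =
      (p (n + 1)).q * modifiedHeights M p (n + 1) + modifiedHeights M p n := by
  rw [modifiedHeights, heights, (hp (n + 1)).σtot_eq]
  rfl

theorem topSpacerCount_le_heights (hp : ∀ n, IsContinuedFractionStep N M K p n) (hM : M ≤ N)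
    (n : ℕ) : topSpacerCount M p n ≤ heights p n := by
  match n with
  | 0 => simp [topSpacerCount]
  | 1 => rwa [(hp 0).heights_one]
  | n + 2 => exact (heights_strictMono p).monotone (by omega)

theorem Zmax_le_heights (hp : ∀ n, IsContinuedFractionStep N M K p n) (hM : M ≤ N) (n : ℕ) :
    Zmax p n ≤ heights p n := by
  refine Finset.sup_le fun j hj => Finset.sup_le fun i _ => ?_
  rw [(hp j).σ_eq]
  split_ifs
  · exact (topSpacerCount_le_heights hp hM j).trans
      ((heights_strictMono p).monotone (by simpa [Nat.lt_succ_iff] using hj))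
  · exact Nat.zero_le _

theorem exists_conjugate_rot (hp : ∀ n, IsContinuedFractionStep N M K p n) (hM : 0 < M) {c e : ℤ}
    (hdet : c * M - e * N = 1) {X : Type} [MeasurableSpace X] [StandardBorelSpace X] {T : X ≃ᵐ X}
    {μ : Measure X} [IsProbabilityMeasure μ] [NullSingletonClass μ] (hT : IsRankOneWith μ T p) :
    ∃ θ : ℝ, K * |θ - c / N| ≤ 1 ∧ Irrational θ ∧
      Conjugate (volume : Measure (AddCircle (1 : ℝ))) (rot θ) μ T := by
  set H := modifiedHeights M p
  set P := convergentNum e c fun n => (p n).q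
  have hHpos : ∀ n, 0 < H n := fun n => by
    cases n with
    | zero => exact hM
    | succ n => exact (Nat.succ_pos _).trans_le (heights_add_one_le p (n + 1)).2
  have hHrec : ∀ n, H (n + 2) = (p (n + 1)).q * H (n + 1) + H n := modifiedHeights_add_two hp
  have hPrec : ∀ n, P (n + 2) = (p (n + 1)).q * P (n + 1) + P n := fun n => rfl
  have hH1 : H 1 = N := (hp 0).heights_one
  have hdet0 : P 1 * H 0 - P 0 * H 1 = 1 := by rwa [hH1]
  obtain ⟨θ, hθ⟩ := exists_angle_of_convergents (a := fun n => (p n).q) hHpos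
    (fun n => two_pos.trans_le (p (n + 1)).two_le_q) hHrec hPrec hdet0
  have hdet' := convergent_det (a := fun n => (p n).q) hHrec hPrec hdet0
  have hlim' : Tendsto (fun n => H (n + 1)) atTop atTop :=
    (heights_strictMono p).tendsto_atTop.comp (tendsto_add_atTop_nat 1)
  have hlim : Tendsto H atTop atTop := (tendsto_add_atTop_iff_nat 1).1 hlim'
  have hirr := irrational_of_convergents hdet' hθ hlim
  refine ⟨θ, ?_, hirr, hT.conjugate_rot (d := fun n => |H n * θ - P n|) hirr ?_ ?_ ?_ ?_ ?_ ?_⟩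
  · have h := abs_angle_sub_convergent_le hHpos hdet' hθ
    have hK : (K : ℝ) ≤ H 2 := by
      have h1 : K ≤ (p 1).q := (hp 1).le_q one_ne_zero
      have h2 : (p 1).q * 1 ≤ (p 1).q * H 1 := Nat.mul_le_mul_left _ (hHpos 1)
      have h3 : H 2 = (p 1).q * H 1 + H 0 := hHrec 0
      exact_mod_cast (by omega : K ≤ H 2)
    have hH2 : (0 : ℝ) < H 2 := by exact_mod_cast hHpos 2
    rw [hH1, le_div_iff₀ hH2] at h
    rw [mul_comm]
    exact (mul_le_mul_of_nonneg_left hK (abs_nonneg _)).trans h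
  · intro n j hj
    rw [(hp n).σ_eq, if_neg hj.ne]
  · intro n
    have h1 := hHrec n
    have h2 := hHpos n
    change _ * H (n + 1) < H (n + 2)
    omega
  · intro n
    exact abs_pos.2 fun h => by simpa [h] using hθ n
  · exact convergent_error_rec (a := fun n => (p n).q) hHrec hPrec hθ
  · exact fun n => UnitAddCircle.norm_nsmul_coe_le θ _ _
  · intro n j hj0 hj
    obtain ⟨m, hm⟩ := UnitAddCircle.exists_norm_zsmul_coe θ j
    rw [hm]
    exact convergent_best_approx hdet' hθ n j m hj0 hj

theorem exists_extension (hp : ∀ k ≤ n, IsContinuedFractionStep N M K p k) (hN : 0 < N)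
    (hM : M ≤ N) {q : ℕ} (hq : 2 ≤ q) (hK : K ≤ q) :
    ∃ P : CSParam, P.q = q ∧ P.σtot ≤ N * q * heights p n ∧
      ∀ k ≤ n + 1, IsContinuedFractionStep N M K (Function.update p (n + 1) P) k := by
  let P : CSParam := ⟨q, hq, fun i => if i = q then topSpacerCount M p (n + 1) else 0,
    fun i hi => if_neg hi.ne'⟩
  have hcongr : ∀ k < n + 1, p k = Function.update p (n + 1) P k := fun k hk => by
    rw [Function.update_of_ne hk.ne]
  have hlast : IsContinuedFractionStep N M K (Function.update p (n + 1) P) (n + 1) := by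
    refine ⟨fun i => ?_, fun h => by omega, fun _ => ?_⟩
    · rw [← topSpacerCount_congr hcongr, Function.update_self]
    · rwa [Function.update_self]
  refine ⟨P, rfl, ?_, fun k hk => ?_⟩
  · have h := hlast.σtot_eq
    rw [← topSpacerCount_congr hcongr, Function.update_self] at h
    rw [h]
    have hle : modifiedHeights M p n ≤ N * heights p n := by
      cases n with
      | zero => simpa [modifiedHeights, heights] using hM
      | succ n => exact Nat.le_mul_of_pos_left _ hN
    calc modifiedHeights M p n ≤ N * heights p n := hle
      _ ≤ N * q * heights p n :=
        Nat.mul_le_mul_right _ (Nat.le_mul_of_pos_right _ (by omega))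
  · rcases hk.eq_or_lt with rfl | hk
    · exact hlast
    · exact (hp k (by omega)).congr fun l hl => hcongr l (by omega)

end IsContinuedFractionStep

/-- For every nonempty open subset `𝒱` of `ℝ`, the set
`{R_θ : θ ∈ 𝒱 irrational}` of irrational rotations with angle in `𝒱` is a flexible
class of rank-one systems. -/
theorem irrational_rotations_with_angle_in_open_set_flexible
    (V : Set ℝ) (hVopen : IsOpen V) (hVne : V.Nonempty) :
    IsFlexibleClass (fun 𝒮 : MSystem => ∃ θ : ℝ, θ ∈ V ∧ Irrational θ ∧
      Conjugate (volume : Measure (AddCircle (1 : ℝ))) (rot θ) 𝒮.μ 𝒮.T) := by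
  obtain ⟨N, M, K, c, e, hN, hM, hMN, hdet, hV⟩ := exists_reduced_fraction_mem hVopen hVne
  refine ⟨{L | ∃ (p : ℕ → CSParam) (n : ℕ), (∀ k ≤ n, IsContinuedFractionStep N M K p k) ∧
    L = List.ofFn fun k : Fin (n + 1) => p k}, ⟨1, one_pos, fun p _ hpF => ?_⟩, ?_, N,
    by exact_mod_cast (by omega : 0 < N), ?_⟩
  · have hp : ∀ n, IsContinuedFractionStep N M K p n := fun n => by
      obtain ⟨p', n', hp', heq⟩ := hpF n
      obtain rfl : n = n' := by simpa using congrArg List.length heq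
      refine (hp' n le_rfl).congr fun k hk => ?_
      exact (congrFun (List.ofFn_injective heq) ⟨k, Nat.lt_succ_of_le hk⟩).symm
    refine ⟨fun n => ?_, fun 𝒮 h𝒮 hT => ?_⟩
    · rw [one_mul]
      exact_mod_cast IsContinuedFractionStep.Zmax_le_heights hp hMN n
    · obtain ⟨hstd, hprob, hatom⟩ := h𝒮
      have : NullSingletonClass 𝒮.μ := hatom
      obtain ⟨θ, hθ, hirr, hconj⟩ := IsContinuedFractionStep.exists_conjugate_rot hp hM hdet hT
      exact ⟨θ, hV θ hθ, hirr, hconj⟩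
  · let P : CSParam := ⟨N, by omega, fun _ => 0, fun _ _ => rfl⟩
    refine ⟨P, ⟨fun _ => P, 0, fun k hk => ?_, by simp⟩, hN⟩
    obtain rfl : k = 0 := by omega
    exact ⟨fun i => by simp [P, topSpacerCount], fun _ => rfl, fun h => absurd rfl h⟩
  · rintro _ ⟨p, n, hp, rfl⟩ _
    refine (Set.Ici_infinite (max 2 K)).mono fun q hq => ?_
    have hq' := max_le_iff.1 (mem_Ici.1 hq)
    obtain ⟨P, hPq, hPσ, hP⟩ :=
      IsContinuedFractionStep.exists_extension hp (by omega) hMN hq'.1 hq'.2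
    refine ⟨P, hPq, ?_, _, n + 1, hP, ?_⟩
    · rw [List.ofFn_succ', List.concat_eq_append, List.dropLast_concat]
      simp only [Fin.val_castSucc]
      rw [listHeight_ofFn]
      exact_mod_cast hPσ
    · rw [List.ofFn_succ' (n := n + 1), List.concat_eq_append]
      simp only [Fin.val_castSucc, Fin.val_last, Function.update_self]
      congr 2
      funext k
      rw [Function.update_of_ne k.isLt.ne]
end

section
/- Let (q_n)_{n≥0} be a sequence of integers with q_n ≥ 2 and (σ_n)_{n≥0} a sequence of nonnegative integers, and define h_0 = 1 and h_{n+1} = q_n·h_n + σ_n. Then the following are equivalent: (1) the series Σ_n σ_n/h_{n+1} converges; (2) the series Σ_n σ_n/(q_0⋯q_n) converges; (3) there exists a constant M_0 with 0 < M_0 ≤ 1 such that h_{n+1} ∼ (q_0⋯q_n)/M_0 as n → ∞ (i.e. M_0·h_{n+1}/(q_0⋯q_n) → 1). Moreover, if these hold, then Σ_{n≥0} σ_n/(q_0⋯q_n) = 1/M_0 − 1. -/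
open Filter

/-- Abel–Dini: dividing the terms of a nonnegative series by the shifted partial sums does not
change whether it converges. -/
theorem summable_div_one_add_sum_range_iff {a : ℕ → ℝ} (ha : ∀ n, 0 ≤ a n) :
    (Summable fun n => a n / (1 + ∑ k ∈ Finset.range (n + 1), a k)) ↔ Summable a := by
  set x : ℕ → ℝ := fun n => 1 + ∑ k ∈ Finset.range n, a k with hx
  have one_le (n : ℕ) : 1 ≤ x n := le_add_of_nonneg_right (Finset.sum_nonneg fun k _ => ha k)
  have mono : Monotone x := monotone_nat_of_le_succ fun n => by
    simp only [hx, Finset.sum_range_succ]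
    linarith [ha n]
  have pos (n : ℕ) : 0 < x n := one_pos.trans_le (one_le n)
  have nonneg (n : ℕ) : 0 ≤ a n / x (n + 1) := div_nonneg (ha n) (pos _).le
  change (Summable fun n => a n / x (n + 1)) ↔ _
  refine ⟨fun hs => ?_, fun hs => hs.of_nonneg_of_le nonneg fun n => div_le_self (ha n) (one_le _)⟩
  obtain ⟨N, hN⟩ := ((tendsto_order.1 (tendsto_sum_nat_add fun n => a n / x (n + 1))).2
    (1 / 2) (by norm_num)).exists
  have tail (m : ℕ) : ∑ k ∈ Finset.range m, a (k + N) ≤ x (N + m) * (1 / 2) := by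
    calc ∑ k ∈ Finset.range m, a (k + N)
        ≤ ∑ k ∈ Finset.range m, x (N + m) * (a (k + N) / x (k + N + 1)) := by
          refine Finset.sum_le_sum fun k hk => ?_
          have hk' := Finset.mem_range.1 hk
          have hle : x (k + N + 1) ≤ x (N + m) := mono (by omega)
          calc a (k + N) = x (k + N + 1) * (a (k + N) / x (k + N + 1)) :=
                (mul_div_cancel₀ _ (pos _).ne').symm
            _ ≤ _ := mul_le_mul_of_nonneg_right hle (nonneg _)
      _ = x (N + m) * ∑ k ∈ Finset.range m, a (k + N) / x (k + N + 1) := by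
          rw [Finset.mul_sum]
      _ ≤ x (N + m) * (1 / 2) := by
          refine mul_le_mul_of_nonneg_left (le_trans ?_ hN.le) (pos _).le
          exact ((summable_nat_add_iff N).2 hs).sum_le_tsum _ fun k _ => nonneg _
  refine (summable_nat_add_iff N).1
    (summable_of_sum_range_le (c := x N) (fun n => ha _) fun m => ?_)
  have split : x (N + m) = x N + ∑ k ∈ Finset.range m, a (k + N) := by
    simp only [hx, Finset.sum_range_add, add_assoc, Nat.add_comm _ N]
  linarith [tail m]

/-- Normalised heights are one plus the partial sums of the normalised spacer counts. -/
theorem height_div_prod_eq_one_add_sum {q σ h : ℕ → ℕ} (hq : ∀ n, q n ≠ 0) (h0 : h 0 = 1)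
    (hrec : ∀ n, h (n + 1) = q n * h n + σ n) (n : ℕ) :
    (h n : ℝ) / ∏ k ∈ Finset.range n, (q k : ℝ) =
      1 + ∑ k ∈ Finset.range n, (σ k : ℝ) / ∏ j ∈ Finset.range (k + 1), (q j : ℝ) := by
  induction n with
  | zero => simp [h0]
  | succ n ih =>
    have hqn : (q n : ℝ) ≠ 0 := Nat.cast_ne_zero.2 (hq n)
    rw [Finset.sum_range_succ, ← add_assoc, ← ih, hrec, Finset.prod_range_succ]
    have hP : ∏ k ∈ Finset.range n, (q k : ℝ) ≠ 0 :=
      Finset.prod_ne_zero_iff.2 fun k _ => Nat.cast_ne_zero.2 (hq k)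
    push_cast
    field_simp

/-- Let `(q_n)` be integers `≥ 2`, `(σ_n)` nonnegative integers, with
`h_0 = 1` and `h_{n+1} = q_n·h_n + σ_n`. The following are equivalent: (1) `Σ σ_n/h_{n+1}`
converges; (2) `Σ σ_n/(q_0⋯q_n)` converges; (3) there exists `0 < M_0 ≤ 1` with
`h_{n+1} ∼ (q_0⋯q_n)/M_0`, i.e. `M_0·h_{n+1}/(q_0⋯q_n) → 1`. Moreover, in that case,
`Σ_{n≥0} σ_n/(q_0⋯q_n) = 1/M_0 − 1`. -/
theorem height_series_equivalences
    (q σ : ℕ → ℕ) (hq : ∀ n, 2 ≤ q n)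
    (h : ℕ → ℕ) (h0 : h 0 = 1) (hrec : ∀ n, h (n + 1) = q n * h n + σ n) :
    ((Summable fun n => (σ n : ℝ) / (h (n + 1) : ℝ)) ↔
      (Summable fun n => (σ n : ℝ) / ∏ k ∈ Finset.range (n + 1), (q k : ℝ))) ∧
    ((Summable fun n => (σ n : ℝ) / (h (n + 1) : ℝ)) ↔
      (∃ M0 : ℝ, 0 < M0 ∧ M0 ≤ 1 ∧
        Tendsto (fun n => M0 * (h (n + 1) : ℝ) / ∏ k ∈ Finset.range (n + 1), (q k : ℝ))
          atTop (nhds 1))) ∧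
    (∀ M0 : ℝ, 0 < M0 → M0 ≤ 1 →
      Tendsto (fun n => M0 * (h (n + 1) : ℝ) / ∏ k ∈ Finset.range (n + 1), (q k : ℝ))
        atTop (nhds 1) →
      ∑' n, (σ n : ℝ) / ∏ k ∈ Finset.range (n + 1), (q k : ℝ) = 1 / M0 - 1) := by
  have hq0 (n : ℕ) : q n ≠ 0 := by have := hq n; omega
  have hP (n : ℕ) : 0 < ∏ k ∈ Finset.range n, (q k : ℝ) :=
    Finset.prod_pos fun k _ => Nat.cast_pos.2 (Nat.pos_of_ne_zero (hq0 k))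
  set a : ℕ → ℝ := fun n => (σ n : ℝ) / ∏ k ∈ Finset.range (n + 1), (q k : ℝ) with ha
  have ha0 (n : ℕ) : 0 ≤ a n := div_nonneg (Nat.cast_nonneg _) (hP _).le
  have hx := height_div_prod_eq_one_add_sum hq0 h0 hrec
  have hterm : (fun n => (σ n : ℝ) / (h (n + 1) : ℝ)) =
      fun n => a n / (1 + ∑ k ∈ Finset.range (n + 1), a k) := by
    funext n
    rw [← hx (n + 1), ha, div_div_div_cancel_right₀ (hP _).ne']
  have h12 : (Summable fun n => (σ n : ℝ) / (h (n + 1) : ℝ)) ↔ Summable a := by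
    rw [hterm]
    exact summable_div_one_add_sum_range_iff ha0
  have hratio (M0 : ℝ) :
      (fun n => M0 * (h (n + 1) : ℝ) / ∏ k ∈ Finset.range (n + 1), (q k : ℝ)) =
        fun n => M0 * (1 + ∑ k ∈ Finset.range (n + 1), a k) := by
    funext n
    rw [mul_div_assoc, hx]
  have hasSum {M0 : ℝ} (hM : 0 < M0)
      (ht : Tendsto (fun n => M0 * (h (n + 1) : ℝ) / ∏ k ∈ Finset.range (n + 1), (q k : ℝ))
        atTop (nhds 1)) : HasSum a (1 / M0 - 1) := by
    rw [hasSum_iff_tendsto_nat_of_nonneg ha0, ← tendsto_add_atTop_iff_nat 1]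
    rw [hratio] at ht
    refine ((ht.div_const M0).sub_const 1).congr fun n => ?_
    rw [mul_div_cancel_left₀ _ hM.ne', add_sub_cancel_left]
  refine ⟨h12, h12.trans ⟨fun hs => ?_, fun ⟨M0, hM, _, ht⟩ => (hasSum hM ht).summable⟩,
    fun M0 hM _ ht => (hasSum hM ht).tsum_eq⟩
  have hS : 0 ≤ ∑' n, a n := tsum_nonneg ha0
  refine ⟨(1 + ∑' n, a n)⁻¹, by positivity, inv_le_one_of_one_le₀ (by linarith), ?_⟩
  rw [hratio]
  have ht := (((tendsto_add_atTop_iff_nat 1).2 hs.hasSum.tendsto_sum_nat).const_add 1).const_mul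
    (1 + ∑' n, a n)⁻¹
  rwa [inv_mul_cancel₀ (by positivity)] at ht
end

section
/- With the combinatorial quantities r_{n,m}, t_{n,m}, q'_n defined by the stated recurrences from sequences (p_n), (q_n), (σ_n), assume that for every n ≥ 0 one has q_n > p_n and q_n > q'_k for all k < n. Then q'_n ≥ p_n > 0 for every n ≥ 0, and t_{n,m} ≥ 1 for all integers m > n ≥ 1 (so all the 'largest multiples' occurring in the orbit-equivalence construction are nonzero and the construction is well-defined). -/
open Filter

/-- With the combinatorial quantities `r_{n,m}`, `t_{n,m}`, `q'_n`
defined by the stated recurrences from sequences `(p_n)` (primes), `(q_n)` (cutting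
parameters `≥ 2`) and `(σ_n)` (spacer counts), if `q_n > p_n` and `q_n > q'_k` for all
`k < n`, then `q'_n ≥ p_n > 0` for every `n ≥ 0` and `t_{n,m} ≥ 1` for all `m > n ≥ 1`
(so all the "largest multiples" occurring in the orbit-equivalence construction are
nonzero and the construction is well-defined). -/
theorem construction_well_defined
    (P q σ : ℕ → ℕ) (hP : ∀ n, (P n).Prime) (hq : ∀ n, 2 ≤ q n)
    (h : ℕ → ℕ) (h0 : h 0 = 1) (hrec : ∀ n, h (n + 1) = q n * h n + σ n)
    (r t : ℕ → ℕ → ℕ) (q' : ℕ → ℕ)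
    (ht01 : t 0 1 = 0)
    (ht0m : ∀ m, 2 ≤ m → t 0 m = σ (m - 1))
    (hrnn : ∀ n, 1 ≤ n → r n n = q (n - 1) + t (n - 1) n)
    (hq' : ∀ n, 1 ≤ n → q' (n - 1) = (r n n - 1) / P (n - 1) * P (n - 1))
    (htnn : ∀ n, 1 ≤ n → t n n = 1)
    (hrnm : ∀ n m, 1 ≤ n → n < m →
      r n m = q (m - 1) * (r n (m - 1) - q' (n - 1) * t n (m - 1)) + t (n - 1) m)
    (htnm : ∀ n m, 1 ≤ n → n < m → t n m = (r n m - 1) / q' (n - 1))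
    (hcond : ∀ n, P n < q n ∧ ∀ k < n, q' k < q n)
    :
    (∀ n, 0 < P n ∧ P n ≤ q' n) ∧ (∀ n m, 1 ≤ n → n < m → 1 ≤ t n m) := by
  have hr : ∀ n, P n < r (n + 1) (n + 1) := fun n => by
    have h1 := hrnn (n + 1) (by omega)
    have h2 := (hcond n).1
    simp only [Nat.add_sub_cancel] at h1
    omega
  have hq'n : ∀ n, q' n = (r (n + 1) (n + 1) - 1) / P n * P n := fun n =>
    hq' (n + 1) (by omega)
  have hle : ∀ n, P n ≤ q' n := fun n => by
    rw [hq'n]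
    have h1 := hr n
    exact Nat.le_mul_of_pos_left _ (Nat.div_pos (by omega) (hP n).pos)
  have step : ∀ n m, n + 1 ≤ m → q' n * t (n + 1) m < r (n + 1) m →
      q' n < r (n + 1) (m + 1) := fun n m hnm hlt => by
    have h1 := hrnm (n + 1) (m + 1) (by omega) (by omega)
    simp only [Nat.add_sub_cancel] at h1
    have h2 : q m ≤ q m * (r (n + 1) m - q' n * t (n + 1) m) :=
      Nat.le_mul_of_pos_right _ (by omega)
    have h3 := (hcond m).2 n (by omega)
    omega
  have key : ∀ n m, n + 1 ≤ m → q' n * t (n + 1) m < r (n + 1) m := fun n m hnm => by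
    induction m, hnm using Nat.le_induction with
    | base =>
      have h1 := Nat.div_mul_le_self (r (n + 1) (n + 1) - 1) (P n)
      have h2 := hr n
      rw [← hq'n] at h1
      rw [htnn (n + 1) (by omega)]
      omega
    | succ m hnm ih =>
      have h1 := step n m hnm ih
      have h2 := htnm (n + 1) (m + 1) (by omega) (by omega)
      simp only [Nat.add_sub_cancel] at h2
      have h3 := Nat.mul_div_le (r (n + 1) (m + 1) - 1) (q' n)
      rw [← h2] at h3
      omega
  refine ⟨fun n => ⟨(hP n).pos, hle n⟩, fun n m hn hnm => ?_⟩
  obtain ⟨n, rfl⟩ := Nat.exists_eq_add_of_le' hn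
  obtain ⟨m, rfl⟩ := Nat.exists_eq_add_of_le' (show 1 ≤ m by omega)
  have h1 := step n m (by omega) (key n m (by omega))
  rw [htnm (n + 1) (m + 1) hn hnm, Nat.add_sub_cancel]
  exact Nat.div_pos (by omega) ((hP n).pos.trans_le (hle n))
end

section
/- With the combinatorial quantities r_{n,m}, t_{n,m}, q'_n defined by the stated recurrences from sequences (p_n), (q_n), (σ_n), and assuming for every n ≥ 0 that q_n > p_n and q_n > q'_k for all k < n (so that in particular q'_ℓ ≥ 2 for all ℓ ≥ 1), one has for every n ≥ 1 the upper bound q'_n ≤ 3·q_n + σ_n/(q'_0·q'_1⋯q'_{n−1}). -/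
open Filter

/-- Removing from `a` the largest multiple of `d` not exceeding `a - 1` leaves at most `d`. -/
theorem sub_one_sub_div_mul_le (a : ℕ) {d : ℕ} (hd : 0 < d) : a - (a - 1) / d * d ≤ d := by
  have h1 := Nat.div_add_mod' (a - 1) d
  have h2 := Nat.mod_lt (a - 1) hd
  omega

/-- With the combinatorial quantities `r_{n,m}`, `t_{n,m}`, `q'_n`
defined by the stated recurrences, and assuming `q_n > p_n` and `q_n > q'_k` for all
`k < n`, one has, for every `n ≥ 1`, the upper bound
`q'_n ≤ 3·q_n + σ_n/(q'_0 ⋯ q'_{n−1})`. -/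
theorem cutting_parameter_upper_bound
    (P q σ : ℕ → ℕ) (hP : ∀ n, (P n).Prime) (hq : ∀ n, 2 ≤ q n)
    (h : ℕ → ℕ) (h0 : h 0 = 1) (hrec : ∀ n, h (n + 1) = q n * h n + σ n)
    (r t : ℕ → ℕ → ℕ) (q' : ℕ → ℕ)
    (ht01 : t 0 1 = 0)
    (ht0m : ∀ m, 2 ≤ m → t 0 m = σ (m - 1))
    (hrnn : ∀ n, 1 ≤ n → r n n = q (n - 1) + t (n - 1) n)
    (hq' : ∀ n, 1 ≤ n → q' (n - 1) = (r n n - 1) / P (n - 1) * P (n - 1))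
    (htnn : ∀ n, 1 ≤ n → t n n = 1)
    (hrnm : ∀ n m, 1 ≤ n → n < m →
      r n m = q (m - 1) * (r n (m - 1) - q' (n - 1) * t n (m - 1)) + t (n - 1) m)
    (htnm : ∀ n m, 1 ≤ n → n < m → t n m = (r n m - 1) / q' (n - 1))
    (hcond : ∀ n, P n < q n ∧ ∀ k < n, q' k < q n)
    :
    ∀ n, 1 ≤ n →
      (q' n : ℝ) ≤ 3 * (q n : ℝ) + (σ n : ℝ) / ∏ k ∈ Finset.range n, (q' k : ℝ) := by
  have hP_le : ∀ k, P k ≤ q' k := by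
    intro k
    have h1 := hq' (k + 1) (by omega)
    have h2 := hrnn (k + 1) (by omega)
    have h3 := (hcond k).1
    simp only [Nat.add_sub_cancel] at h1 h2
    rw [h1]
    exact Nat.le_mul_of_pos_left _ (Nat.div_pos (by omega) (hP k).pos)
  have h_two : ∀ k, 2 ≤ q' k := fun k => (hP k).two_le.trans (hP_le k)
  have h_rem : ∀ k m, k + 1 ≤ m → r (k + 1) m - q' k * t (k + 1) m ≤ q' k := by
    intro k m hkm
    rcases hkm.eq_or_lt with rfl | hlt
    · have h1 := hq' (k + 1) (by omega)
      have h2 := sub_one_sub_div_mul_le (r (k + 1) (k + 1)) (hP k).pos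
      simp only [Nat.add_sub_cancel] at h1
      rw [htnn _ (by omega), mul_one]
      rw [← h1] at h2
      exact h2.trans (hP_le k)
    · have h1 := htnm (k + 1) m (by omega) hlt
      simp only [Nat.add_sub_cancel] at h1
      rw [h1, mul_comm]
      exact sub_one_sub_div_mul_le _ (zero_lt_two.trans_le (h_two k))
  have h_step : ∀ k m, k + 1 < m →
      t (k + 1) m * q' k ≤ q (m - 1) * q' k + t k m := by
    intro k m hkm
    have h1 := htnm (k + 1) m (by omega) hkm
    have h2 := hrnm (k + 1) m (by omega) hkm
    simp only [Nat.add_sub_cancel] at h1 h2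
    have h3 := Nat.mul_le_mul_left (q (m - 1)) (h_rem k (m - 1) (by omega))
    have h4 := Nat.div_mul_le_self (r (k + 1) m - 1) (q' k)
    rw [← h1] at h4
    omega
  have h_bound : ∀ m, 2 ≤ m → ∀ k < m, (t k m : ℝ) ≤
      2 * (q (m - 1) : ℝ) + (σ (m - 1) : ℝ) / ∏ i ∈ Finset.range k, (q' i : ℝ) := by
    intro m hm k
    induction k with
    | zero =>
      intro _
      simp [ht0m m hm]
    | succ k ih =>
      intro hk
      have h1 : (t (k + 1) m : ℝ) * q' k ≤ q (m - 1) * q' k + t k m := by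
        exact_mod_cast h_step k m hk
      have h2 : (2 : ℝ) ≤ q' k := by exact_mod_cast h_two k
      have h3 := ih (by omega)
      rw [Finset.prod_range_succ, ← div_div]
      set S := (σ (m - 1) : ℝ) / ∏ i ∈ Finset.range k, (q' i : ℝ)
      have h4 : (0 : ℝ) < q' k := by linarith
      refine le_of_mul_le_mul_right ?_ h4
      rw [add_mul, div_mul_cancel₀ _ h4.ne']
      have h5 := mul_le_mul_of_nonneg_left h2 (Nat.cast_nonneg (α := ℝ) (q (m - 1)))
      linarith
  intro n hn
  have h1 : q' n ≤ q n + t n (n + 1) := by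
    have h1 := hq' (n + 1) (by omega)
    have h2 := hrnn (n + 1) (by omega)
    have h3 := Nat.div_mul_le_self (r (n + 1) (n + 1) - 1) (P n)
    simp only [Nat.add_sub_cancel] at h1 h2
    omega
  have h2 : (q' n : ℝ) ≤ q n + t n (n + 1) := by exact_mod_cast h1
  have h3 := h_bound (n + 1) (by omega) n (by omega)
  simp only [Nat.add_sub_cancel] at h3
  linarith
end

section
/- Let 0 < α ≤ 1 and let φ : [0,∞) → [0,∞) satisfy φ(t) = o(t^α) as t → ∞. Then there exists Φ : [0,∞) → [0,∞) such that: Φ is increasing; Φ is subadditive (Φ(t+s) ≤ Φ(t) + Φ(s) for all t,s ≥ 0); Φ(t) = o(t^α) as t → ∞; and φ(t) = O(Φ(t)) as t → ∞. -/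
open Filter

/-- The pointwise infimum of the functions `t ↦ a + δ * t ^ α` over all pairs `(a, δ) ∈ S`. -/
noncomputable def rpowEnvelope (α : ℝ) (S : Set (ℝ × ℝ)) (t : ℝ) : ℝ :=
  ⨅ p : S, (p.1.1 + p.1.2 * t ^ α)

section rpowEnvelope

variable {α : ℝ} {S : Set (ℝ × ℝ)}

theorem rpowEnvelope_le (hS : ∀ p ∈ S, 0 ≤ p.1 ∧ 0 ≤ p.2) {t : ℝ} (ht : 0 ≤ t)
    {p : ℝ × ℝ} (hp : p ∈ S) : rpowEnvelope α S t ≤ p.1 + p.2 * t ^ α := by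
  refine ciInf_le (f := fun p : S => p.1.1 + p.1.2 * t ^ α) ⟨0, ?_⟩ ⟨p, hp⟩
  rintro _ ⟨q, rfl⟩
  have hq := hS q q.2
  exact add_nonneg hq.1 (mul_nonneg hq.2 (Real.rpow_nonneg ht α))

theorem le_rpowEnvelope (hne : S.Nonempty) {t c : ℝ}
    (h : ∀ p ∈ S, c ≤ p.1 + p.2 * t ^ α) : c ≤ rpowEnvelope α S t := by
  have := hne.to_subtype
  exact le_ciInf fun p => h p p.2

theorem rpowEnvelope_nonneg (hS : ∀ p ∈ S, 0 ≤ p.1 ∧ 0 ≤ p.2) (hne : S.Nonempty)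
    {t : ℝ} (ht : 0 ≤ t) : 0 ≤ rpowEnvelope α S t :=
  le_rpowEnvelope hne fun p hp =>
    add_nonneg (hS p hp).1 (mul_nonneg (hS p hp).2 (Real.rpow_nonneg ht α))

theorem rpowEnvelope_mono (hα : 0 ≤ α) (hS : ∀ p ∈ S, 0 ≤ p.1 ∧ 0 ≤ p.2) (hne : S.Nonempty)
    {t s : ℝ} (ht : 0 ≤ t) (hts : t ≤ s) : rpowEnvelope α S t ≤ rpowEnvelope α S s :=
  le_rpowEnvelope hne fun p hp => (rpowEnvelope_le hS ht hp).trans <| by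
    have := (hS p hp).2
    gcongr

theorem mul_rpowEnvelope_le (hα1 : α ≤ 1) (hS : ∀ p ∈ S, 0 ≤ p.1 ∧ 0 ≤ p.2)
    (hne : S.Nonempty) {c x : ℝ} (hc0 : 0 < c) (hc1 : c ≤ 1) (hx : 0 ≤ x) :
    c * rpowEnvelope α S x ≤ rpowEnvelope α S (c * x) := by
  refine le_rpowEnvelope hne fun p hp => ?_
  have hp0 := hS p hp
  have hcα : c ≤ c ^ α := Real.self_le_rpow_of_le_one hc0.le hc1 hα1
  have hxα : 0 ≤ x ^ α := Real.rpow_nonneg hx α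
  calc c * rpowEnvelope α S x ≤ c * (p.1 + p.2 * x ^ α) := by
        gcongr
        exact rpowEnvelope_le hS hx hp
    _ = c * p.1 + p.2 * (c * x ^ α) := by ring
    _ ≤ p.1 + p.2 * (c ^ α * x ^ α) := by
        have := hp0.2
        gcongr
        exact mul_le_of_le_one_left hp0.1 hc1
    _ = p.1 + p.2 * (c * x) ^ α := by rw [Real.mul_rpow hc0.le hx]

theorem rpowEnvelope_add_le (hα1 : α ≤ 1) (hS : ∀ p ∈ S, 0 ≤ p.1 ∧ 0 ≤ p.2)
    (hne : S.Nonempty) {t s : ℝ} (ht : 0 ≤ t) (hs : 0 ≤ s) :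
    rpowEnvelope α S (t + s) ≤ rpowEnvelope α S t + rpowEnvelope α S s := by
  rcases ht.eq_or_lt with rfl | ht'
  · simpa using rpowEnvelope_nonneg (α := α) hS hne le_rfl
  rcases hs.eq_or_lt with rfl | hs'
  · simpa using rpowEnvelope_nonneg (α := α) hS hne le_rfl
  have hx : 0 < t + s := by positivity
  have h₁ := mul_rpowEnvelope_le hα1 hS hne (div_pos ht' hx)
    ((div_le_one hx).2 (by linarith)) hx.le
  have h₂ := mul_rpowEnvelope_le hα1 hS hne (div_pos hs' hx)
    ((div_le_one hx).2 (by linarith)) hx.le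
  rw [div_mul_cancel₀ _ hx.ne'] at h₁ h₂
  calc rpowEnvelope α S (t + s)
      = t / (t + s) * rpowEnvelope α S (t + s) + s / (t + s) * rpowEnvelope α S (t + s) := by
        field_simp
    _ ≤ _ := add_le_add h₁ h₂

theorem tendsto_rpowEnvelope_div (hα : 0 < α) (hS : ∀ p ∈ S, 0 ≤ p.1 ∧ 0 ≤ p.2)
    (hsmall : ∀ δ : ℝ, 0 < δ → ∃ a, (a, δ) ∈ S) :
    Tendsto (fun t : ℝ => rpowEnvelope α S t / t ^ α) atTop (nhds 0) := by
  have hne : S.Nonempty := let ⟨a, ha⟩ := hsmall 1 one_pos; ⟨(a, 1), ha⟩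
  rw [tendsto_order]
  constructor
  · intro b hb
    filter_upwards [eventually_ge_atTop 0] with t ht
    exact hb.trans_le (div_nonneg (rpowEnvelope_nonneg hS hne ht) (Real.rpow_nonneg ht α))
  · intro b hb
    obtain ⟨a, ha⟩ := hsmall (b / 2) (half_pos hb)
    filter_upwards [eventually_gt_atTop 0,
      (tendsto_rpow_atTop hα).eventually_gt_atTop (a / (b / 2))] with t ht hta
    rw [div_lt_iff₀ (half_pos hb)] at hta
    rw [div_lt_iff₀ (Real.rpow_pos_of_pos ht α)]
    have := rpowEnvelope_le (α := α) hS ht.le ha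
    dsimp only at this
    linarith

end rpowEnvelope

theorem exists_le_add_mul_rpow_of_tendsto {α T : ℝ} (hα : 0 ≤ α) (hT : 0 < T) {φ : ℝ → ℝ}
    (hφT : ∀ s, T ≤ s → φ s ≤ s ^ α)
    (hφ : Tendsto (fun t : ℝ => φ t / t ^ α) atTop (nhds 0)) {δ : ℝ} (hδ : 0 < δ) :
    ∃ a, 0 ≤ a ∧ ∀ s, T ≤ s → φ s ≤ a + δ * s ^ α := by
  obtain ⟨X, hX⟩ := eventually_atTop.1 (hφ.eventually_lt_const hδ)
  have hXα : 0 ≤ |X| ^ α := Real.rpow_nonneg (abs_nonneg X) α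
  refine ⟨|X| ^ α, hXα, fun s hs => ?_⟩
  have hs0 : 0 < s := hT.trans_le hs
  have hsα : 0 < s ^ α := Real.rpow_pos_of_pos hs0 α
  rcases le_total X s with h | h
  · linarith [(div_lt_iff₀ hsα).1 (hX s h)]
  · have : s ^ α ≤ |X| ^ α := Real.rpow_le_rpow hs0.le (h.trans (le_abs_self X)) hα
    linarith [hφT s hs, mul_pos hδ hsα]

/-- Let `0 < α ≤ 1` and let `φ : [0,∞) → [0,∞)` satisfy
`φ(t) = o(t^α)` as `t → ∞`. Then there exists `Φ : [0,∞) → [0,∞)` which is increasing,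
subadditive, satisfies `Φ(t) = o(t^α)` as `t → ∞`, and `φ(t) = O(Φ(t))` as `t → ∞`. -/
theorem exists_increasing_subadditive_majorant
    (α : ℝ) (hα0 : 0 < α) (hα1 : α ≤ 1)
    (φ : ℝ → ℝ) (hφ0 : ∀ t : ℝ, 0 ≤ t → 0 ≤ φ t)
    (hφ : Tendsto (fun t : ℝ => φ t / t ^ α) atTop (nhds 0)) :
    ∃ Φ : ℝ → ℝ, (∀ t : ℝ, 0 ≤ t → 0 ≤ Φ t) ∧
      StrictMonoOn Φ (Set.Ici (0 : ℝ)) ∧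
      (∀ t s : ℝ, 0 ≤ t → 0 ≤ s → Φ (t + s) ≤ Φ t + Φ s) ∧
      Tendsto (fun t : ℝ => Φ t / t ^ α) atTop (nhds 0) ∧
      ∃ K t₀ : ℝ, 0 < K ∧ 0 < t₀ ∧ ∀ t : ℝ, t₀ ≤ t → φ t ≤ K * Φ t := by
  obtain ⟨T₀, hT₀⟩ := eventually_atTop.1 (hφ.eventually_lt_const one_pos)
  set T := max T₀ 1
  have hT : 0 < T := one_pos.trans_le (le_max_right _ _)
  have hφT : ∀ s, T ≤ s → φ s ≤ s ^ α := fun s hs => by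
    have h := hT₀ s ((le_max_left _ _).trans hs)
    rw [div_lt_one (Real.rpow_pos_of_pos (hT.trans_le hs) α)] at h
    exact h.le
  let S : Set (ℝ × ℝ) := {p | (0 ≤ p.1 ∧ 0 ≤ p.2) ∧ ∀ s, T ≤ s → φ s ≤ p.1 + p.2 * s ^ α}
  have hS : ∀ p ∈ S, 0 ≤ p.1 ∧ 0 ≤ p.2 := fun p hp => hp.1
  have hsmall : ∀ δ : ℝ, 0 < δ → ∃ a, (a, δ) ∈ S := fun δ hδ =>
    let ⟨a, ha, h⟩ := exists_le_add_mul_rpow_of_tendsto hα0.le hT hφT hφ hδ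
    ⟨a, ⟨ha, hδ.le⟩, h⟩
  have hne : S.Nonempty := let ⟨a, ha⟩ := hsmall 1 one_pos; ⟨(a, 1), ha⟩
  have hβ : 0 < α / 2 := half_pos hα0
  refine ⟨fun t => rpowEnvelope α S t + t ^ (α / 2), fun t ht => ?_, fun t ht s hs hts => ?_,
    fun t s ht hs => ?_, ?_, 1, T, one_pos, hT, fun t ht => ?_⟩
  · exact add_nonneg (rpowEnvelope_nonneg hS hne ht) (Real.rpow_nonneg ht _)
  · exact add_lt_add_of_le_of_lt (rpowEnvelope_mono hα0.le hS hne ht hts.le)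
      (Real.rpow_lt_rpow ht hts hβ)
  · have h₁ := rpowEnvelope_add_le hα1 hS hne ht hs
    have h₂ := Real.rpow_add_le_add_rpow ht hs hβ.le (by linarith : α / 2 ≤ 1)
    dsimp only
    linarith
  · have h := (tendsto_rpowEnvelope_div hα0 hS hsmall).add (tendsto_rpow_neg_atTop hβ)
    rw [add_zero] at h
    refine h.congr' ?_
    filter_upwards [eventually_gt_atTop 0] with t ht
    rw [add_div, ← Real.rpow_sub ht]
    ring_nf
  · have h := le_rpowEnvelope hne (c := φ t) fun p hp => hp.2 t ht
    have := Real.rpow_nonneg (hT.le.trans ht) (α / 2)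
    dsimp only
    linarith
end
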